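/- arXiv:2511.10606 — 11 statements merged into one kernel-verified Lean document; each statement's English description precedes it below -/
import Mathlib

section
/- Let A, W ∈ SL₂(ℂ) and set x = tr A, y = tr W, z = tr(AW). Then tr(A W A⁻¹ W⁻¹ A⁻¹) - tr(A⁻¹ W⁻¹ A W A W⁻¹) = x - x*y + (x² + y² + z² - x*y*z - 3)*z. -/
/-- Let `A, W ∈ SL₂(ℂ)` and set `x = tr A`, `y = tr W`, `z = tr (A*W)`.
Then `tr (A W A⁻¹ W⁻¹ A⁻¹) - tr (A⁻¹ W⁻¹ A W A W⁻¹)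
  = x - x*y + (x² + y² + z² - x*y*z - 3) * z`. -/
theorem trace_difference_Q
    (A W : Matrix.SpecialLinearGroup (Fin 2) ℂ)
    (x y z : ℂ)
    (hx : x = Matrix.trace (A : Matrix (Fin 2) (Fin 2) ℂ))
    (hy : y = Matrix.trace (W : Matrix (Fin 2) (Fin 2) ℂ))
    (hz : z = Matrix.trace ((A * W : Matrix.SpecialLinearGroup (Fin 2) ℂ) :
        Matrix (Fin 2) (Fin 2) ℂ)) :
    Matrix.trace ((A * W * A⁻¹ * W⁻¹ * A⁻¹ : Matrix.SpecialLinearGroup (Fin 2) ℂ) :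
        Matrix (Fin 2) (Fin 2) ℂ)
      - Matrix.trace ((A⁻¹ * W⁻¹ * A * W * A * W⁻¹ : Matrix.SpecialLinearGroup (Fin 2) ℂ) :
        Matrix (Fin 2) (Fin 2) ℂ)
      = x - x * y + (x ^ 2 + y ^ 2 + z ^ 2 - x * y * z - 3) * z := by
  have hA := A.det_coe
  have hW := W.det_coe
  rw [Matrix.det_fin_two] at hA hW
  subst hx hy hz
  simp only [Matrix.SpecialLinearGroup.coe_mul, Matrix.SpecialLinearGroup.coe_inv,
    Matrix.adjugate_fin_two, Matrix.trace_fin_two, Matrix.mul_apply, Fin.sum_univ_two,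
    Matrix.of_apply, Matrix.cons_val_zero, Matrix.cons_val_one, Matrix.cons_val_fin_one]
  generalize (A : Matrix (Fin 2) (Fin 2) ℂ) 0 0 = a at *
  generalize (A : Matrix (Fin 2) (Fin 2) ℂ) 0 1 = b at *
  generalize (A : Matrix (Fin 2) (Fin 2) ℂ) 1 0 = c at *
  generalize (A : Matrix (Fin 2) (Fin 2) ℂ) 1 1 = d at *
  generalize (W : Matrix (Fin 2) (Fin 2) ℂ) 0 0 = p at *
  generalize (W : Matrix (Fin 2) (Fin 2) ℂ) 0 1 = q at *
  generalize (W : Matrix (Fin 2) (Fin 2) ℂ) 1 0 = r at *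
  generalize (W : Matrix (Fin 2) (Fin 2) ℂ) 1 1 = s at *
  grind
end

section
/- Let A, W ∈ SL₂(ℂ), set x = tr A, y = tr W, z = tr(AW), and let U = A W A⁻¹ W⁻¹ A⁻¹ and V = A⁻¹ W⁻¹ A W A W⁻¹. Then for every integer n, tr(Wⁿ U A) - tr(V Wⁿ A) = (y + 2 - x*z - x² - z² + x*y*z) * S_{n-2}(y) - (y² + y - 2 + z² - x*y*z) * S_{n-3}(y). -/
open Matrix in
/-- The Cayley-Hamilton theorem in `SL₂`. -/
theorem Matrix.SpecialLinearGroup.coe_mul_self {R : Type*} [CommRing R]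
    (W : SpecialLinearGroup (Fin 2) R) :
    (W : Matrix (Fin 2) (Fin 2) R) * W =
      trace (W : Matrix (Fin 2) (Fin 2) R) • (W : Matrix (Fin 2) (Fin 2) R) - 1 := by
  have h := W.det_coe
  rw [det_fin_two] at h
  ext i j
  fin_cases i <;> fin_cases j <;>
    simp [Matrix.mul_apply, Fin.sum_univ_two, trace_fin_two] <;> grind

open Matrix in
theorem Matrix.SpecialLinearGroup.coe_inv_eq {R : Type*} [CommRing R]
    (W : SpecialLinearGroup (Fin 2) R) :
    ((W⁻¹ : SpecialLinearGroup (Fin 2) R) : Matrix (Fin 2) (Fin 2) R) =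
      trace (W : Matrix (Fin 2) (Fin 2) R) • 1 - (W : Matrix (Fin 2) (Fin 2) R) := by
  rw [SpecialLinearGroup.coe_inv, adjugate_fin_two]
  ext i j
  fin_cases i <;> fin_cases j <;> simp [trace_fin_two]

open Matrix in
/-- Powers in `SL₂` through the Chebyshev recurrence. -/
theorem Matrix.SpecialLinearGroup.coe_zpow_eq {R : Type*} [CommRing R]
    (W : SpecialLinearGroup (Fin 2) R) (s : ℤ → R) (h0 : s 0 = 1)
    (h1 : s 1 = trace (W : Matrix (Fin 2) (Fin 2) R))
    (hrec : ∀ k, s k = trace (W : Matrix (Fin 2) (Fin 2) R) * s (k - 1) - s (k - 2)) (n : ℤ) :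
    ((W ^ n : SpecialLinearGroup (Fin 2) R) : Matrix (Fin 2) (Fin 2) R) =
      s (n - 1) • (W : Matrix (Fin 2) (Fin 2) R) - s (n - 2) • 1 := by
  have hneg1 : s (-1) = 0 := by
    have := hrec 1
    norm_num [h0, h1] at this
    linear_combination this
  have hneg2 : s (-2) = -1 := by
    have := hrec 0
    norm_num [h0, hneg1] at this
    rw [this, neg_neg]
  induction n using Int.induction_on with
  | zero => simp [hneg1, hneg2]
  | succ k ih =>
    have h := hrec k
    rw [_root_.zpow_add_one, SpecialLinearGroup.coe_mul, ih, sub_mul, smul_mul_assoc, coe_mul_self,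
      show (k : ℤ) + 1 - 1 = k by ring, show (k : ℤ) + 1 - 2 = k - 1 by ring, h, smul_mul_assoc,
      one_mul]
    module
  | pred k ih =>
    have h := hrec (-k - 1)
    have e : s (-(k : ℤ) - 1 - 2) = trace (W : Matrix (Fin 2) (Fin 2) R) * s (-k - 2) -
        s (-k - 1) := by
      rw [h, show -(k : ℤ) - 1 - 1 = -k - 2 by ring]
      ring
    rw [_root_.zpow_sub_one, SpecialLinearGroup.coe_mul, ih, coe_inv_eq, sub_mul, smul_mul_assoc, mul_sub,
      coe_mul_self, show -(k : ℤ) - 1 - 1 = -k - 2 by ring, e, mul_smul_comm, mul_one,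
      smul_mul_assoc, one_mul]
    module

open Matrix in
theorem Matrix.SpecialLinearGroup.trace_mul_mul_mul_inv {R : Type*} [CommRing R]
    (A B : SpecialLinearGroup (Fin 2) R) :
    trace ((A * B * A * B⁻¹ : SpecialLinearGroup (Fin 2) R) : Matrix (Fin 2) (Fin 2) R) =
      2 - trace (B : Matrix (Fin 2) (Fin 2) R) ^ 2
        - trace ((A * B : SpecialLinearGroup (Fin 2) R) : Matrix (Fin 2) (Fin 2) R) ^ 2
        + trace (A : Matrix (Fin 2) (Fin 2) R) * trace (B : Matrix (Fin 2) (Fin 2) R)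
          * trace ((A * B : SpecialLinearGroup (Fin 2) R) : Matrix (Fin 2) (Fin 2) R) := by
  have hA := A.det_coe
  have hB := B.det_coe
  rw [det_fin_two] at hA hB
  simp only [SpecialLinearGroup.coe_mul, coe_inv_eq, trace_fin_two, Matrix.mul_apply,
    Fin.sum_univ_two, Matrix.sub_apply, Matrix.smul_apply, Matrix.one_apply, smul_eq_mul]
  simp
  grind

open Matrix in
theorem Matrix.SpecialLinearGroup.trace_conj {n R : Type*} [Fintype n] [DecidableEq n]
    [CommRing R] (P Q : SpecialLinearGroup n R) :
    trace ((P * Q * P⁻¹ : SpecialLinearGroup n R) : Matrix n n R) = trace (Q : Matrix n n R) := by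
  rw [SpecialLinearGroup.coe_mul, trace_mul_comm, ← SpecialLinearGroup.coe_mul,
    ← mul_assoc, inv_mul_cancel, one_mul]

open Matrix in
theorem Matrix.SpecialLinearGroup.trace_mul_self_mul {R : Type*} [CommRing R]
    (A B : SpecialLinearGroup (Fin 2) R) :
    trace ((A * B * A : SpecialLinearGroup (Fin 2) R) : Matrix (Fin 2) (Fin 2) R) =
      trace (A : Matrix (Fin 2) (Fin 2) R)
        * trace ((A * B : SpecialLinearGroup (Fin 2) R) : Matrix (Fin 2) (Fin 2) R)
        - trace (B : Matrix (Fin 2) (Fin 2) R) := by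
  rw [SpecialLinearGroup.coe_mul, trace_mul_comm, SpecialLinearGroup.coe_mul, ← mul_assoc,
    coe_mul_self, sub_mul, trace_sub, smul_mul_assoc, trace_smul, one_mul, smul_eq_mul]


/-- Let `S k` be the Chebyshev polynomials of the second kind
(`S 0 y = 1`, `S 1 y = y`, `S k y = y * S (k-1) y - S (k-2) y` for all integers `k`).
Let `A, W ∈ SL₂(ℂ)`, set `x = tr A`, `y = tr W`, `z = tr (A*W)`, and let
`U = A W A⁻¹ W⁻¹ A⁻¹`, `V = A⁻¹ W⁻¹ A W A W⁻¹`. Then for every integer `n`,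
`tr (Wⁿ U A) - tr (V Wⁿ A)
  = (y + 2 - x*z - x² - z² + x*y*z) * S (n-2) y - (y² + y - 2 + z² - x*y*z) * S (n-3) y`. -/
theorem trace_difference_Rn
    (S : ℤ → ℂ → ℂ)
    (hS0 : ∀ y : ℂ, S 0 y = 1)
    (hS1 : ∀ y : ℂ, S 1 y = y)
    (hSrec : ∀ (k : ℤ) (y : ℂ), S k y = y * S (k - 1) y - S (k - 2) y)
    (A W : Matrix.SpecialLinearGroup (Fin 2) ℂ)
    (x y z : ℂ)
    (hx : x = Matrix.trace (A : Matrix (Fin 2) (Fin 2) ℂ))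
    (hy : y = Matrix.trace (W : Matrix (Fin 2) (Fin 2) ℂ))
    (hz : z = Matrix.trace ((A * W : Matrix.SpecialLinearGroup (Fin 2) ℂ) :
        Matrix (Fin 2) (Fin 2) ℂ))
    (U V : Matrix.SpecialLinearGroup (Fin 2) ℂ)
    (hU : U = A * W * A⁻¹ * W⁻¹ * A⁻¹)
    (hV : V = A⁻¹ * W⁻¹ * A * W * A * W⁻¹)
    (n : ℤ) :
    Matrix.trace ((W ^ n * U * A : Matrix.SpecialLinearGroup (Fin 2) ℂ) :
        Matrix (Fin 2) (Fin 2) ℂ)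
      - Matrix.trace ((V * W ^ n * A : Matrix.SpecialLinearGroup (Fin 2) ℂ) :
        Matrix (Fin 2) (Fin 2) ℂ)
      = (y + 2 - x * z - x ^ 2 - z ^ 2 + x * y * z) * S (n - 2) y
        - (y ^ 2 + y - 2 + z ^ 2 - x * y * z) * S (n - 3) y := by
  have htr : ∀ P Q R : Matrix.SpecialLinearGroup (Fin 2) ℂ, P = R * Q * R⁻¹ →
      Matrix.trace (P : Matrix (Fin 2) (Fin 2) ℂ) = Matrix.trace (Q : Matrix (Fin 2) (Fin 2) ℂ) :=
    fun P Q R h => h ▸ Matrix.SpecialLinearGroup.trace_conj R Q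
  have hzc : z = Matrix.trace ((W * A : Matrix.SpecialLinearGroup (Fin 2) ℂ) :
      Matrix (Fin 2) (Fin 2) ℂ) := by
    rw [hz]
    exact htr _ _ A (by group)
  have hU1 : Matrix.trace ((W * U * A : Matrix.SpecialLinearGroup (Fin 2) ℂ) :
      Matrix (Fin 2) (Fin 2) ℂ) = y := by
    rw [hy]
    exact htr _ _ (W * A) (by rw [hU]; group)
  have hU2 : Matrix.trace ((W * W * U * A : Matrix.SpecialLinearGroup (Fin 2) ℂ) :
      Matrix (Fin 2) (Fin 2) ℂ) = 2 - x ^ 2 - z ^ 2 + y * x * z := by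
    rw [hx, hy, hzc, ← Matrix.SpecialLinearGroup.trace_mul_mul_mul_inv]
    exact htr _ _ W (by rw [hU]; group)
  have hV1 : Matrix.trace ((V * W * A : Matrix.SpecialLinearGroup (Fin 2) ℂ) :
      Matrix (Fin 2) (Fin 2) ℂ) = 2 - y ^ 2 - z ^ 2 + x * y * z := by
    rw [hx, hy, hz, ← Matrix.SpecialLinearGroup.trace_mul_mul_mul_inv]
    exact htr _ _ (A⁻¹ * W⁻¹) (by rw [hV]; group)
  have hV2 : Matrix.trace ((V * (W * W) * A : Matrix.SpecialLinearGroup (Fin 2) ℂ) :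
      Matrix (Fin 2) (Fin 2) ℂ) = x * z - y := by
    rw [hx, hy, hz, ← Matrix.SpecialLinearGroup.trace_mul_self_mul]
    exact htr _ _ (A⁻¹ * W⁻¹) (by rw [hV]; group)
  have hpow : ((W ^ n : Matrix.SpecialLinearGroup (Fin 2) ℂ) : Matrix (Fin 2) (Fin 2) ℂ) =
      S (n - 2) y • ((W : Matrix (Fin 2) (Fin 2) ℂ) * W)
        - S (n - 3) y • (W : Matrix (Fin 2) (Fin 2) ℂ) := by
    have h := W.coe_zpow_eq (fun k => S k y) (hS0 y) (by rw [← hy, hS1])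
      (fun k => by rw [← hy]; exact hSrec k y) (n - 1)
    rw [show n - 1 - 1 = n - 2 by ring, show n - 1 - 2 = n - 3 by ring] at h
    rw [← sub_add_cancel n 1, zpow_add_one, Matrix.SpecialLinearGroup.coe_mul, h, sub_mul,
      smul_mul_assoc, smul_mul_assoc, one_mul, sub_add_cancel]
  simp only [Matrix.SpecialLinearGroup.coe_mul] at hU1 hU2 hV1 hV2 ⊢
  simp only [hpow, sub_mul, mul_sub, smul_mul_assoc, mul_smul_comm, Matrix.trace_sub,
    Matrix.trace_smul, smul_eq_mul, hU1, hU2, hV1, hV2]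
  ring
end

section
/- Let n ≥ 3 be an integer and let x, y, z, r be complex numbers such that r ≠ 0, r - r⁻¹ = S_{n-2}(y), S_{n-2}(y) ≠ 0, x = z*(y + 1 - (S_{n-3}(y) + r)/S_{n-2}(y)), and z² = 1 + (S_{n-2}(y) - S_{n-3}(y))*r. Then Q = 0 and R_n = 0, where Q = x - x*y + (x² + y² + z² - x*y*z - 3)*z and R_n = (y + 2 - x*z - x² - z² + x*y*z)*S_{n-2}(y) - (y² + y - 2 + z² - x*y*z)*S_{n-3}(y). -/
/-- The quadratic invariant of the recurrence `S k = y * S (k - 1) - S (k - 2)`. -/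
theorem chebyshev_recurrence_invariant (S : ℤ → ℂ → ℂ)
    (hS0 : ∀ y : ℂ, S 0 y = 1)
    (hS1 : ∀ y : ℂ, S 1 y = y)
    (hSrec : ∀ (k : ℤ) (y : ℂ), S k y = y * S (k - 1) y - S (k - 2) y)
    (k : ℤ) (y : ℂ) :
    S (k + 1) y ^ 2 + S k y ^ 2 - y * S (k + 1) y * S k y = 1 := by
  have step (m : ℤ) : S (m + 1 + 1) y = y * S (m + 1) y - S m y := by
    have h := hSrec (m + 1 + 1) y
    rwa [show m + 1 + 1 - 1 = m + 1 by ring, show m + 1 + 1 - 2 = m by ring] at h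
  induction k using Int.induction_on with
  | zero =>
    rw [zero_add, hS0, hS1]
    ring
  | succ m ih =>
    rw [step]
    linear_combination ih
  | pred m ih =>
    have h := step (-(m : ℤ) - 1)
    rw [sub_add_cancel] at h ⊢
    rw [h] at ih
    linear_combination ih


/-- Proposition `sol`. Let `S k` be the Chebyshev polynomials of the
second kind (`S 0 y = 1`, `S 1 y = y`, `S k y = y * S (k-1) y - S (k-2) y` for all
integers `k`). Let `n ≥ 3` be an integer and `x, y, z, r` complex numbers with `r ≠ 0`,
`r - r⁻¹ = S (n-2) y`, `S (n-2) y ≠ 0`, `x = z*(y + 1 - (S (n-3) y + r)/S (n-2) y)` and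
`z² = 1 + (S (n-2) y - S (n-3) y)*r`. Then `Q = 0` and `R_n = 0`. -/
theorem Q_and_Rn_vanish
    (S : ℤ → ℂ → ℂ)
    (hS0 : ∀ y : ℂ, S 0 y = 1)
    (hS1 : ∀ y : ℂ, S 1 y = y)
    (hSrec : ∀ (k : ℤ) (y : ℂ), S k y = y * S (k - 1) y - S (k - 2) y)
    (n : ℤ) (hn : 3 ≤ n)
    (x y z r : ℂ)
    (hr0 : r ≠ 0)
    (hr : r - r⁻¹ = S (n - 2) y)
    (hSne : S (n - 2) y ≠ 0)
    (hx : x = z * (y + 1 - (S (n - 3) y + r) / S (n - 2) y))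
    (hz : z ^ 2 = 1 + (S (n - 2) y - S (n - 3) y) * r) :
    x - x * y + (x ^ 2 + y ^ 2 + z ^ 2 - x * y * z - 3) * z = 0 ∧
    (y + 2 - x * z - x ^ 2 - z ^ 2 + x * y * z) * S (n - 2) y
      - (y ^ 2 + y - 2 + z ^ 2 - x * y * z) * S (n - 3) y = 0 := by
  have hinv := chebyshev_recurrence_invariant S hS0 hS1 hSrec (n - 3) y
  rw [show n - 3 + 1 = n - 2 by ring] at hinv
  generalize S (n - 2) y = a at *
  generalize S (n - 3) y = b at *
  have hr2 : r ^ 2 = 1 + a * r := by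
    rw [← hr]
    field_simp
    ring
  obtain ⟨t, ht⟩ : ∃ t, t = y + 1 - (b + r) / a := ⟨_, rfl⟩
  rw [← ht] at hx
  have hat : a * t = a * y + a - b - r := by
    rw [ht]
    field_simp
    ring
  clear hr ht hn hS0 hS1 hSrec
  have hq : t * (1 - y) + y ^ 2 - 3 + z ^ 2 * (t ^ 2 + 1 - t * y) = 0 := by
    rw [hz]
    grind
  have hR : (y + 2 - z ^ 2 * (t + t ^ 2 + 1 - t * y)) * a
      - (y ^ 2 + y - 2 + z ^ 2 * (1 - t * y)) * b = 0 := by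
    rw [hz]
    grind
  subst hx
  constructor
  · linear_combination z * hq
  · linear_combination hR
end

section
/- Let n ≥ 1 be an integer, θ a real number, and t = e^{iθ}. Then t^{2n+5} - t^{2n+3} + t^{2n+2} + t³ - t² + 1 = 0 if and only if 2cos((n+1)θ)*cos(3θ/2) - cos((2n+1)θ/2) = 0. -/
open Real

/-- Euler's formula for the cosine of `k * x / 2` in terms of the half-angle exponential. -/
lemma ofReal_cos_natCast_mul_half (k : ℕ) (x : ℝ) :
    ((Real.cos (k * x / 2) : ℝ) : ℂ) =
      (Complex.exp (x / 2 * Complex.I) ^ k + (Complex.exp (x / 2 * Complex.I))⁻¹ ^ k) / 2 := by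
  rw [← Complex.exp_neg, ← Complex.exp_nat_mul, ← Complex.exp_nat_mul, Complex.ofReal_cos,
    Complex.cos]
  push_cast
  ring_nf

/-- Let `n ≥ 1` be an integer, `θ` real, and `t = e^{iθ}`. Then
`t^{2n+5} - t^{2n+3} + t^{2n+2} + t³ - t² + 1 = 0` if and only if
`2 cos ((n+1)θ) cos (3θ/2) - cos ((2n+1)θ/2) = 0`. -/
theorem alexander_roots_on_circle
    (n : ℕ) (hn : 1 ≤ n) (θ : ℝ) (t : ℂ)
    (ht : t = Complex.exp (θ * Complex.I)) :
    t ^ (2 * n + 5) - t ^ (2 * n + 3) + t ^ (2 * n + 2) + t ^ 3 - t ^ 2 + 1 = 0 ↔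
      2 * Real.cos (((n : ℝ) + 1) * θ) * Real.cos (3 * θ / 2)
        - Real.cos ((2 * (n : ℝ) + 1) * θ / 2) = 0 := by
  have h₁ := ofReal_cos_natCast_mul_half (2 * n + 2) θ
  have h₂ := ofReal_cos_natCast_mul_half 3 θ
  have h₃ := ofReal_cos_natCast_mul_half (2 * n + 1) θ
  rw [show ((2 * n + 2 : ℕ) : ℝ) * θ / 2 = ((n : ℝ) + 1) * θ by push_cast; ring] at h₁
  rw [Nat.cast_ofNat] at h₂
  rw [show ((2 * n + 1 : ℕ) : ℝ) = 2 * (n : ℝ) + 1 by push_cast; ring] at h₃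
  have hts : t = Complex.exp (θ / 2 * Complex.I) ^ 2 := by
    rw [ht, ← Complex.exp_nat_mul]
    push_cast
    ring_nf
  have hs : Complex.exp (θ / 2 * Complex.I) ≠ 0 := Complex.exp_ne_zero _
  generalize Complex.exp (θ / 2 * Complex.I) = s at *
  have key : t ^ (2 * n + 5) - t ^ (2 * n + 3) + t ^ (2 * n + 2) + t ^ 3 - t ^ 2 + 1 =
      2 * s ^ (2 * n + 5) * ((2 * Real.cos (((n : ℝ) + 1) * θ) * Real.cos (3 * θ / 2)
        - Real.cos ((2 * (n : ℝ) + 1) * θ / 2) : ℝ) : ℂ) := by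
    rw [Complex.ofReal_sub, Complex.ofReal_mul, Complex.ofReal_mul, h₁, h₂, h₃, hts]
    simp only [inv_pow, ← pow_mul, Complex.ofReal_ofNat]
    field_simp
    ring
  rw [key, mul_eq_zero, Complex.ofReal_eq_zero]
  simp [hs]
end

section
/- Let n ≥ 3 be an integer. The equation F(θ) = 0 has a unique solution θ_n in the interval [α_n, β_n], and moreover θ_n ∈ [α_n, γ_n). -/
open Real

/-- The left endpoint `α_n` of the interval considered for the `(-2,3,2n+1)`-pretzel knot. -/
noncomputable def alphaN (n : ℕ) : ℝ :=
  if n % 3 = 0 then 2 * π / 3 - π / (6 * (n : ℝ) + 15)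
  else if n % 3 = 1 then 2 * π / 3 + π / (6 * (n : ℝ) - 3)
  else 2 * π / 3 - π / (2 * (n : ℝ) + 5)

/-- The right endpoint `β_n` of the interval considered for the `(-2,3,2n+1)`-pretzel knot. -/
noncomputable def betaN (n : ℕ) : ℝ :=
  if n % 3 = 0 then 2 * π / 3 + π / (6 * (n : ℝ) + 3)
  else if n % 3 = 1 then 2 * π / 3 + π / (2 * (n : ℝ) + 1)
  else 2 * π / 3 - π / (6 * (n : ℝ) + 3)

/-- The interior point `γ_n ∈ (α_n, β_n)`. -/
noncomputable def gammaN (n : ℕ) : ℝ :=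
  if n % 3 = 0 then 2 * π / 3
  else if n % 3 = 1 then 2 * π / 3 + 4 * π / (12 * (n : ℝ) + 9)
  else 2 * π / 3 - 4 * π / (12 * (n : ℝ) + 9)

/-- `F θ = 2 cos ((n+1)θ) cos (3θ/2) - cos ((2n+1)θ/2)`. -/
noncomputable def FN (n : ℕ) (θ : ℝ) : ℝ :=
  2 * Real.cos (((n : ℝ) + 1) * θ) * Real.cos (3 * θ / 2)
    - Real.cos ((2 * (n : ℝ) + 1) * θ / 2)

theorem FN_eq_cos_add_cos_sub_cos (n : ℕ) (θ : ℝ) :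
    FN n θ = cos ((2 * n + 5) * θ / 2) + cos ((2 * n - 1) * θ / 2)
      - cos ((2 * n + 1) * θ / 2) := by
  have h1 : (2 * (n : ℝ) + 5) * θ / 2 = (n + 1) * θ + 3 * θ / 2 := by ring
  have h2 : (2 * (n : ℝ) - 1) * θ / 2 = (n + 1) * θ - 3 * θ / 2 := by ring
  rw [FN, h1, h2, cos_add, cos_sub]
  ring

theorem FN_two_pi_div_three_add_of_mod_eq_zero {n : ℕ} (h : n % 3 = 0) (t : ℝ) :
    FN n (2 * π / 3 + t) = cos (n * t + 5 / 2 * t - π / 3) + cos (n * t - t / 2 - π / 3)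
      - cos (n * t + t / 2 + π / 3) := by
  obtain ⟨m, rfl⟩ : ∃ m, n = 3 * m := ⟨n / 3, by omega⟩
  rw [FN_eq_cos_add_cos_sub_cos, ← cos_add_nat_mul_two_pi (_ + 5 / 2 * t - π / 3) (m + 1),
    ← cos_add_nat_mul_two_pi (_ - t / 2 - π / 3) m,
    ← cos_add_nat_mul_two_pi (_ + t / 2 + π / 3) m]
  push_cast
  ring_nf

theorem FN_two_pi_div_three_add_of_mod_eq_one {n : ℕ} (h : n % 3 = 1) (t : ℝ) :
    FN n (2 * π / 3 + t) = cos (n * t + 5 / 2 * t + π / 3) + cos (n * t - t / 2 + π / 3)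
      + cos (n * t + t / 2) := by
  obtain ⟨m, rfl⟩ : ∃ m, n = 3 * m + 1 := ⟨n / 3, by omega⟩
  rw [FN_eq_cos_add_cos_sub_cos, ← cos_add_nat_mul_two_pi (_ + 5 / 2 * t + π / 3) (m + 1),
    ← cos_add_nat_mul_two_pi (_ - t / 2 + π / 3) m, ← sub_neg_eq_add _ (cos (_ + t / 2)),
    ← cos_add_pi, ← cos_add_nat_mul_two_pi (_ + π) m]
  push_cast
  ring_nf

theorem FN_two_pi_div_three_add_of_mod_eq_two {n : ℕ} (h : n % 3 = 2) (t : ℝ) :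
    FN n (2 * π / 3 + t) = -(cos (n * t + 5 / 2 * t) + cos (n * t - t / 2)
      + cos (n * t + t / 2 - π / 3)) := by
  obtain ⟨m, rfl⟩ : ∃ m, n = 3 * m + 2 := ⟨n / 3, by omega⟩
  rw [FN_eq_cos_add_cos_sub_cos, ← cos_add_nat_mul_two_pi (_ + t / 2 - π / 3) (m + 1),
    neg_add, neg_add, ← cos_add_pi, ← cos_add_pi,
    ← cos_add_nat_mul_two_pi (_ + 5 / 2 * t + π) (m + 1),
    ← cos_add_nat_mul_two_pi (_ - t / 2 + π) m]
  push_cast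
  ring_nf

theorem cos_lt_cos_of_neg_pi_le_of_nonpos {x y : ℝ} (hx : -π ≤ x) (hy : y ≤ 0) (hxy : x < y) :
    cos x < cos y := by
  rw [← cos_neg x, ← cos_neg y]
  exact cos_lt_cos_of_nonneg_of_le_pi (by linarith) (by linarith) (by linarith)

/-- If the zeros of `f` near `s` are the translates of those of a function `g` that increases
strictly through zero on `[a, c]` and is positive on `[c, b]`, then `f` has exactly one zero in
`[s + a, s + b]`, and this zero lies in `[s + a, s + c)`. -/
theorem exists_unique_root_of_strictMonoOn {f g : ℝ → ℝ} {s a b c : ℝ}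
    (hfg : ∀ t, f (s + t) = 0 ↔ g t = 0) (hg : Continuous g) (hac : a ≤ c) (hcb : c ≤ b)
    (ha : g a ≤ 0) (hmono : StrictMonoOn g (Set.Icc a c)) (hpos : ∀ t ∈ Set.Icc c b, 0 < g t) :
    ∃ x ∈ Set.Icc (s + a) (s + b), f x = 0 ∧ x ∈ Set.Ico (s + a) (s + c) ∧
      ∀ y ∈ Set.Icc (s + a) (s + b), f y = 0 → y = x := by
  have hc := hpos c ⟨le_rfl, hcb⟩
  obtain ⟨t, ⟨hat, htc⟩, ht⟩ := intermediate_value_Icc hac hg.continuousOn ⟨ha, hc.le⟩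
  have htc' : t < c := lt_of_le_of_ne htc (by rintro rfl; linarith)
  refine ⟨s + t, ⟨by linarith, by linarith⟩, (hfg t).2 ht, ⟨by linarith, by linarith⟩, ?_⟩
  rintro y ⟨hay, hyb⟩ hy
  have hgy : g (y - s) = 0 := (hfg _).1 (by rwa [add_sub_cancel])
  have hyc : y - s < c := by
    by_contra! hle
    linarith [hpos (y - s) ⟨hle, by linarith⟩]
  have := hmono.injOn ⟨by linarith, hyc.le⟩ ⟨hat, htc⟩ (hgy.trans ht.symm)
  linarith

theorem F_has_unique_root_of_mod_eq_zero {n : ℕ} (hn : 3 ≤ n) (h : n % 3 = 0) :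
    ∃ θn ∈ Set.Icc (alphaN n) (betaN n), FN n θn = 0 ∧
      θn ∈ Set.Ico (alphaN n) (gammaN n) ∧
      ∀ θ ∈ Set.Icc (alphaN n) (betaN n), FN n θ = 0 → θ = θn := by
  have hα : alphaN n = 2 * π / 3 + -(π / (6 * (n : ℝ) + 15)) := by
    simp [alphaN, h, sub_eq_add_neg]
  have hβ : betaN n = 2 * π / 3 + π / (6 * (n : ℝ) + 3) := by simp [betaN, h]
  have hγ : gammaN n = 2 * π / 3 + 0 := by simp [gammaN, h]
  have hN : (3 : ℝ) ≤ n := by exact_mod_cast hn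
  rw [hα, hβ, hγ]
  set a := π / (6 * (n : ℝ) + 15) with ha
  set b := π / (6 * (n : ℝ) + 3) with hb
  have ha0 : 0 < a := by positivity
  have hb0 : 0 < b := by positivity
  have ha' : 6 * (n * a) + 15 * a = π := by rw [ha]; field_simp
  have hb' : 6 * (n * b) + 3 * b = π := by rw [hb]; field_simp
  have h3a : 3 * a ≤ n * a := by gcongr
  have h3b : 3 * b ≤ n * b := by gcongr
  have hmono : StrictMonoOn (fun t : ℝ => cos (n * t + 5 / 2 * t - π / 3)
      + cos (n * t - t / 2 - π / 3) - cos (n * t + t / 2 + π / 3)) (Set.Icc (-a) b) := by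
    rintro x ⟨hx, -⟩ y ⟨-, hy⟩ hxy
    have hnx : n * -a ≤ n * x := by gcongr
    have hny : n * y ≤ n * b := by gcongr
    have hnxy : n * x < n * y := by gcongr
    have h1 : cos (n * x + 5 / 2 * x - π / 3) < cos (n * y + 5 / 2 * y - π / 3) :=
      cos_lt_cos_of_neg_pi_le_of_nonpos (by linarith) (by linarith) (by linarith)
    have hnxy' : 3 * (y - x) ≤ n * (y - x) := by
      have := sub_pos.2 hxy
      gcongr
    have h2 : cos (n * x - x / 2 - π / 3) < cos (n * y - y / 2 - π / 3) :=
      cos_lt_cos_of_neg_pi_le_of_nonpos (by linarith) (by linarith) (by linarith)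
    have h3 : cos (n * y + y / 2 + π / 3) < cos (n * x + x / 2 + π / 3) :=
      cos_lt_cos_of_nonneg_of_le_pi (by linarith) (by linarith) (by linarith)
    linarith
  refine exists_unique_root_of_strictMonoOn
    (fun t => by rw [FN_two_pi_div_three_add_of_mod_eq_zero h]) (by fun_prop) (by linarith) hb0.le
    ?_ (hmono.mono (Set.Icc_subset_Icc_right hb0.le)) ?_
  · have h1 : cos (n * -a + 5 / 2 * -a - π / 3) = 0 := by
      rw [← cos_neg, ← cos_pi_div_two]
      congr 1
      linarith
    have h2 : cos (n * -a - -a / 2 - π / 3) ≤ cos (n * -a + -a / 2 + π / 3) := by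
      rw [← cos_neg (_ - _)]
      exact cos_le_cos_of_nonneg_of_le_pi (by linarith) (by linarith) (by linarith)
    linarith
  · rintro t ⟨ht0, htb⟩
    refine lt_of_lt_of_le ?_
      (hmono.monotoneOn ⟨by linarith, hb0.le⟩ ⟨by linarith, htb⟩ ht0)
    norm_num [cos_pi_div_three, sub_eq_add_neg]

theorem F_has_unique_root_of_mod_eq_one {n : ℕ} (hn : 3 ≤ n) (h : n % 3 = 1) :
    ∃ θn ∈ Set.Icc (alphaN n) (betaN n), FN n θn = 0 ∧
      θn ∈ Set.Ico (alphaN n) (gammaN n) ∧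
      ∀ θ ∈ Set.Icc (alphaN n) (betaN n), FN n θ = 0 → θ = θn := by
  have hα : alphaN n = 2 * π / 3 + π / (6 * (n : ℝ) - 3) := by simp [alphaN, h]
  have hβ : betaN n = 2 * π / 3 + π / (2 * (n : ℝ) + 1) := by simp [betaN, h]
  have hγ : gammaN n = 2 * π / 3 + 4 * π / (12 * (n : ℝ) + 9) := by simp [gammaN, h]
  have hN : (3 : ℝ) ≤ n := by exact_mod_cast hn
  rw [hα, hβ, hγ]
  have hd : 0 < 6 * (n : ℝ) - 3 := by linarith
  set a := π / (6 * (n : ℝ) - 3) with ha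
  set b := π / (2 * (n : ℝ) + 1) with hb
  set c := 4 * π / (12 * (n : ℝ) + 9) with hc
  have ha0 : 0 < a := by positivity
  have ha' : 6 * (n * a) - 3 * a = π := by rw [ha]; field_simp
  have hb' : 2 * (n * b) + b = π := by rw [hb]; field_simp
  have hc' : 12 * (n * c) + 9 * c = 4 * π := by rw [hc]; field_simp
  have h3a : 3 * a ≤ n * a := by gcongr
  have h3b : 3 * b ≤ n * b := by gcongr
  have hac : a ≤ c := by
    rw [ha, hc, div_le_div_iff₀ hd (by positivity)]
    nlinarith
  have hcb : c ≤ b := by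
    rw [hb, hc, div_le_div_iff₀ (by positivity) (by positivity)]
    nlinarith
  refine exists_unique_root_of_strictMonoOn
    (g := fun t : ℝ => -(cos (n * t + 5 / 2 * t + π / 3)
      + cos (n * t - t / 2 + π / 3) + cos (n * t + t / 2)))
    (fun t => by rw [FN_two_pi_div_three_add_of_mod_eq_one h, neg_eq_zero]) (by fun_prop) hac hcb
    ?_ ?_ ?_
  · have h1 : cos (n * a - a / 2 + π / 3) = 0 := by
      rw [← cos_pi_div_two]
      congr 1
      linarith
    have h2 : cos (π - (n * a + a / 2)) ≤ cos (n * a + 5 / 2 * a + π / 3) :=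
      cos_le_cos_of_nonneg_of_le_pi (by linarith) (by linarith) (by linarith)
    rw [cos_pi_sub] at h2
    linarith
  · rintro x ⟨hx, -⟩ y ⟨-, hy⟩ hxy
    have hnx : n * a ≤ n * x := by gcongr
    have hny : n * y ≤ n * c := by gcongr
    have hnxy : n * x < n * y := by gcongr
    have hnxy' : 3 * (y - x) ≤ n * (y - x) := by
      have := sub_pos.2 hxy
      gcongr
    have h1 : cos (n * y + 5 / 2 * y + π / 3) < cos (n * x + 5 / 2 * x + π / 3) :=
      cos_lt_cos_of_nonneg_of_le_pi (by linarith) (by linarith) (by linarith)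
    have h2 : cos (n * y - y / 2 + π / 3) < cos (n * x - x / 2 + π / 3) :=
      cos_lt_cos_of_nonneg_of_le_pi (by linarith) (by linarith) (by linarith)
    have h3 : cos (n * y + y / 2) < cos (n * x + x / 2) :=
      cos_lt_cos_of_nonneg_of_le_pi (by linarith) (by linarith) (by linarith)
    linarith
  · rintro t ⟨hct, htb⟩
    have hnc : n * c ≤ n * t := by gcongr
    have hnb : n * t ≤ n * b := by gcongr
    have hX : cos (n * t + t + π / 3) < 0 :=
      cos_neg_of_pi_div_two_lt_of_lt (by linarith) (by linarith)
    have hXY : cos (n * t + t + π / 3) ≤ cos (π - (n * t + t / 2)) :=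
      cos_le_cos_of_nonneg_of_le_pi (by linarith) (by linarith) (by linarith)
    have hC : cos (π / 3) < cos (3 * t / 2) :=
      cos_lt_cos_of_nonneg_of_le_pi (by linarith) (by linarith) (by linarith)
    have hsum : cos (n * t + 5 / 2 * t + π / 3) + cos (n * t - t / 2 + π / 3)
        = 2 * cos (n * t + t + π / 3) * cos (3 * t / 2) := by
      rw [two_mul_cos_mul_cos]
      ring_nf
    rw [cos_pi_sub] at hXY
    rw [cos_pi_div_three] at hC
    simp only [hsum]
    nlinarith

theorem F_has_unique_root_of_mod_eq_two {n : ℕ} (hn : 3 ≤ n) (h : n % 3 = 2) :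
    ∃ θn ∈ Set.Icc (alphaN n) (betaN n), FN n θn = 0 ∧
      θn ∈ Set.Ico (alphaN n) (gammaN n) ∧
      ∀ θ ∈ Set.Icc (alphaN n) (betaN n), FN n θ = 0 → θ = θn := by
  have hα : alphaN n = 2 * π / 3 + -(π / (2 * (n : ℝ) + 5)) := by
    simp [alphaN, h, sub_eq_add_neg]
  have hβ : betaN n = 2 * π / 3 + -(π / (6 * (n : ℝ) + 3)) := by
    simp [betaN, h, sub_eq_add_neg]
  have hγ : gammaN n = 2 * π / 3 + -(4 * π / (12 * (n : ℝ) + 9)) := by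
    simp [gammaN, h, sub_eq_add_neg]
  have hN : (5 : ℝ) ≤ n := by exact_mod_cast (by omega : 5 ≤ n)
  rw [hα, hβ, hγ]
  set a := π / (2 * (n : ℝ) + 5) with ha
  set b := π / (6 * (n : ℝ) + 3) with hb
  set c := 4 * π / (12 * (n : ℝ) + 9) with hc
  have hb0 : 0 < b := by positivity
  have ha' : 2 * (n * a) + 5 * a = π := by rw [ha]; field_simp
  have hb' : 6 * (n * b) + 3 * b = π := by rw [hb]; field_simp
  have hc' : 12 * (n * c) + 9 * c = 4 * π := by rw [hc]; field_simp
  have h5a : 5 * a ≤ n * a := by gcongr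
  have hca : c ≤ a := by
    rw [ha, hc, div_le_div_iff₀ (by positivity) (by positivity)]
    nlinarith
  have hbc : b ≤ c := by
    rw [hb, hc, div_le_div_iff₀ (by positivity) (by positivity)]
    nlinarith
  have hmono : StrictMonoOn (fun t : ℝ => cos (n * t + 5 / 2 * t) + cos (n * t - t / 2)
      + cos (n * t + t / 2 - π / 3)) (Set.Icc (-a) (-b)) := by
    rintro x ⟨hx, -⟩ y ⟨-, hy⟩ hxy
    have hnx : n * -a ≤ n * x := by gcongr
    have hny : n * y ≤ n * -b := by gcongr
    have hnxy : n * x < n * y := by gcongr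
    have hnxy' : 5 * (y - x) ≤ n * (y - x) := by
      have := sub_pos.2 hxy
      gcongr
    have h1 : cos (n * x + 5 / 2 * x) < cos (n * y + 5 / 2 * y) :=
      cos_lt_cos_of_neg_pi_le_of_nonpos (by linarith) (by linarith) (by linarith)
    have h2 : cos (n * x - x / 2) < cos (n * y - y / 2) :=
      cos_lt_cos_of_neg_pi_le_of_nonpos (by linarith) (by linarith) (by linarith)
    have h3 : cos (n * x + x / 2 - π / 3) < cos (n * y + y / 2 - π / 3) :=
      cos_lt_cos_of_neg_pi_le_of_nonpos (by linarith) (by linarith) (by linarith)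
    linarith
  refine exists_unique_root_of_strictMonoOn
    (fun t => by rw [FN_two_pi_div_three_add_of_mod_eq_two h, neg_eq_zero]) (by fun_prop)
    (neg_le_neg hca) (neg_le_neg hbc) ?_
    (hmono.mono (Set.Icc_subset_Icc_right (neg_le_neg hbc))) ?_
  · have h1 : cos (n * -a + 5 / 2 * -a) = 0 := by
      rw [← cos_neg, ← cos_pi_div_two]
      congr 1
      linarith
    have h2 : cos (-(n * -a + -a / 2 - π / 3)) ≤ cos (π - -(n * -a - -a / 2)) :=
      cos_le_cos_of_nonneg_of_le_pi (by linarith) (by linarith) (by linarith)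
    rw [cos_pi_sub, cos_neg, cos_neg] at h2
    linarith
  · rintro t ⟨hct, htb⟩
    refine lt_of_lt_of_le ?_
      (hmono.monotoneOn ⟨neg_le_neg hca, neg_le_neg hbc⟩ ⟨by linarith, htb⟩ hct)
    have hX : 0 < cos (n * c + c) := cos_pos_of_mem_Ioo ⟨by linarith, by linarith⟩
    have hC : cos (π / 3) < cos (3 * c / 2) :=
      cos_lt_cos_of_nonneg_of_le_pi (by linarith) (by linarith) (by linarith)
    have hsum : cos (n * -c + 5 / 2 * -c) + cos (n * -c - -c / 2)
        = 2 * cos (n * c + c) * cos (3 * c / 2) := by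
      rw [two_mul_cos_mul_cos, ← cos_neg, ← cos_neg (_ - -c / 2), add_comm]
      ring_nf
    have hY : cos (n * -c + -c / 2 - π / 3) = -cos (n * c + c) := by
      rw [← cos_pi_sub, ← cos_neg]
      congr 1
      linarith
    rw [cos_pi_div_three] at hC
    simp only [hsum, hY]
    nlinarith

/-- Proposition `root`. For every integer `n ≥ 3`, the equation
`F(θ) = 0` has a unique solution `θ_n` on `[α_n, β_n]`; moreover `θ_n ∈ [α_n, γ_n)`. -/
theorem F_has_unique_root (n : ℕ) (hn : 3 ≤ n) :
    ∃ θn ∈ Set.Icc (alphaN n) (betaN n), FN n θn = 0 ∧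
      θn ∈ Set.Ico (alphaN n) (gammaN n) ∧
      ∀ θ ∈ Set.Icc (alphaN n) (betaN n), FN n θ = 0 → θ = θn := by
  obtain h | h | h : n % 3 = 0 ∨ n % 3 = 1 ∨ n % 3 = 2 := by omega
  · exact F_has_unique_root_of_mod_eq_zero hn h
  · exact F_has_unique_root_of_mod_eq_one hn h
  · exact F_has_unique_root_of_mod_eq_two hn h
end

section
/- Let n ≥ 3 be an integer and assume θ_n ∈ [α_n, γ_n) satisfies F(θ_n) = 0. Then for every θ ∈ [θ_n, β_n], writing y = 2cos θ: if n ≡ 0 (mod 3) then S_{n-2}(y) < 0 and S_{n-2}(y) - S_{n-3}(y) < 0; if n ≢ 0 (mod 3) then S_{n-2}(y) > 0 and S_{n-2}(y) - S_{n-3}(y) > 0. -/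
open Real

/-- `S k (2 cos θ) sin θ = sin ((k + 1) θ)` for a Chebyshev sequence of the second kind. -/
theorem chebyshev_two_cos_mul_sin (S : ℤ → ℝ → ℝ)
    (hS0 : ∀ y : ℝ, S 0 y = 1) (hS1 : ∀ y : ℝ, S 1 y = y)
    (hSrec : ∀ (k : ℤ) (y : ℝ), S k y = y * S (k - 1) y - S (k - 2) y) (θ : ℝ) (k : ℕ) :
    S k (2 * cos θ) * sin θ = sin (((k : ℝ) + 1) * θ) := by
  induction k using Nat.twoStepInduction with
  | zero => simp [hS0]
  | one =>
    push_cast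
    rw [hS1, one_add_one_eq_two, sin_two_mul]
    ring
  | more k ih₀ ih₁ =>
    have e₁ : ((k + 2 : ℕ) : ℤ) - 1 = ((k + 1 : ℕ) : ℤ) := by push_cast; ring
    have e₂ : ((k + 2 : ℕ) : ℤ) - 2 = (k : ℤ) := by push_cast; ring
    rw [hSrec, e₁, e₂, sub_mul, mul_assoc, ih₁, ih₀]
    push_cast
    have h₀ : ((k : ℝ) + 1) * θ = ((k : ℝ) + 1 + 1) * θ - θ := by ring
    have h₂ : ((k : ℝ) + 2 + 1) * θ = ((k : ℝ) + 1 + 1) * θ + θ := by ring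
    rw [h₀, h₂, sin_sub, sin_add]
    ring

/-- `(S (k + 1) - S k) (2 cos θ) cos (θ / 2) = cos ((k + 3 / 2) θ)` for `0 < θ < π`. -/
theorem chebyshev_sub_mul_cos_half (S : ℤ → ℝ → ℝ)
    (hS0 : ∀ y : ℝ, S 0 y = 1) (hS1 : ∀ y : ℝ, S 1 y = y)
    (hSrec : ∀ (k : ℤ) (y : ℝ), S k y = y * S (k - 1) y - S (k - 2) y)
    {θ : ℝ} (h0 : 0 < θ) (hπ : θ < π) (k : ℕ) :
    (S (k + 1 : ℕ) (2 * cos θ) - S k (2 * cos θ)) * cos (θ / 2) =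
      cos (((k : ℝ) + 3 / 2) * θ) := by
  have hs : 0 < sin (θ / 2) := sin_pos_of_pos_of_lt_pi (by linarith) (by linarith)
  have h₀ := chebyshev_two_cos_mul_sin S hS0 hS1 hSrec θ k
  have h₁ := chebyshev_two_cos_mul_sin S hS0 hS1 hSrec θ (k + 1)
  push_cast at h₁ ⊢
  rw [show ((k : ℝ) + 1) * θ = ((k : ℝ) + 3 / 2) * θ - θ / 2 by ring, sin_sub] at h₀
  rw [show ((k : ℝ) + 1 + 1) * θ = ((k : ℝ) + 3 / 2) * θ + θ / 2 by ring, sin_add] at h₁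
  have hd : sin θ = 2 * sin (θ / 2) * cos (θ / 2) := by rw [← sin_two_mul]; ring_nf
  rw [hd] at h₀ h₁
  apply mul_left_cancel₀ (mul_pos two_pos hs).ne'
  linarith

theorem mul_lt_of_le_div {a b c d x : ℝ} (hx : x ≤ c / d) (ha : 0 ≤ a) (hd : 0 < d)
    (h : a * c < b * d) : a * x < b :=
  calc a * x ≤ a * (c / d) := mul_le_mul_of_nonneg_left hx ha
    _ = a * c / d := by ring
    _ < b := (div_lt_iff₀ hd).2 h

/-- Lemma `sign`. Let `S k` be the Chebyshev polynomials of the second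
kind (`S 0 y = 1`, `S 1 y = y`, `S k y = y * S (k-1) y - S (k-2) y` for all integers `k`).
Let `n ≥ 3` and `θ_n ∈ [α_n, γ_n)` with `F(θ_n) = 0`. Then for every `θ ∈ [θ_n, β_n]`,
writing `y = 2 cos θ`: if `n ≡ 0 (mod 3)` then `S (n-2) y < 0` and
`S (n-2) y - S (n-3) y < 0`; if `n ≢ 0 (mod 3)` then `S (n-2) y > 0` and
`S (n-2) y - S (n-3) y > 0`. -/
theorem chebyshev_sign_on_interval
    (S : ℤ → ℝ → ℝ)
    (hS0 : ∀ y : ℝ, S 0 y = 1)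
    (hS1 : ∀ y : ℝ, S 1 y = y)
    (hSrec : ∀ (k : ℤ) (y : ℝ), S k y = y * S (k - 1) y - S (k - 2) y)
    (n : ℕ) (hn : 3 ≤ n)
    (θn : ℝ) (hθn : θn ∈ Set.Ico (alphaN n) (gammaN n)) (hFθn : FN n θn = 0) :
    ∀ θ ∈ Set.Icc θn (betaN n),
      (n % 3 = 0 →
        S ((n : ℤ) - 2) (2 * Real.cos θ) < 0 ∧
        S ((n : ℤ) - 2) (2 * Real.cos θ) - S ((n : ℤ) - 3) (2 * Real.cos θ) < 0) ∧
      (n % 3 ≠ 0 →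
        0 < S ((n : ℤ) - 2) (2 * Real.cos θ) ∧
        0 < S ((n : ℤ) - 2) (2 * Real.cos θ) - S ((n : ℤ) - 3) (2 * Real.cos θ)) := by
  rintro θ ⟨hθ, hβ⟩
  replace hθ : alphaN n ≤ θ := hθn.1.trans hθ
  clear hθn hFθn
  obtain ⟨δ, rfl⟩ : ∃ δ, θ = 2 * π / 3 + δ := ⟨θ - 2 * π / 3, by ring⟩
  have hpi := pi_pos
  have hn' : (3 : ℝ) ≤ n := by exact_mod_cast hn
  -- The estimates on `δ` that each residue class needs.
  have bounds : (-(π / 6) < δ ∧ δ < π / 6) ∧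
      (n % 3 = 0 → (-(π / 6) < ((n : ℝ) - 1) * δ ∧ ((n : ℝ) - 1) * δ < π / 6) ∧
        (-(π / 6) < ((n : ℝ) - 3 / 2) * δ ∧ ((n : ℝ) - 3 / 2) * δ < π / 6)) ∧
      (n % 3 = 1 → (0 < ((n : ℝ) - 1) * δ ∧ ((n : ℝ) - 1) * δ < π / 2) ∧
        (0 < ((n : ℝ) - 3 / 2) * δ ∧ ((n : ℝ) - 3 / 2) * δ < π / 2)) ∧
      (n % 3 = 2 → (-(π / 2) < ((n : ℝ) - 1) * δ ∧ ((n : ℝ) - 1) * δ < 0) ∧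
        (-(π / 2) < ((n : ℝ) - 3 / 2) * δ ∧ ((n : ℝ) - 3 / 2) * δ < 0)) := by
    have h3 : n % 3 < 3 := Nat.mod_lt _ (by norm_num)
    unfold alphaN at hθ
    unfold betaN at hβ
    obtain h | h | h : n % 3 = 0 ∨ n % 3 = 1 ∨ n % 3 = 2 := by omega
    · simp only [h, if_true] at hθ hβ
      have hl : -δ ≤ π / (6 * (n : ℝ) + 15) := by linarith
      have hu : δ ≤ π / (6 * (n : ℝ) + 3) := by linarith
      have key : ∀ a : ℝ, 0 ≤ a → a ≤ n - 1 → -(π / 6) < a * δ ∧ a * δ < π / 6 := by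
        intro a ha han
        have h₁ := mul_lt_of_le_div (b := π / 6) hl ha (by linarith) (by nlinarith)
        have h₂ := mul_lt_of_le_div (b := π / 6) hu ha (by linarith) (by nlinarith)
        constructor <;> linarith
      refine ⟨by simpa using key 1 (by norm_num) (by linarith), fun _ => ⟨key _ (by linarith)
        le_rfl, key _ (by linarith) (by linarith)⟩, by omega, by omega⟩
    · simp only [h, one_ne_zero, if_true, if_false] at hθ hβ
      have hl : 0 < δ := by
        have : 0 < π / (6 * (n : ℝ) - 3) := div_pos hpi (by linarith)
        linarith
      have hu : δ ≤ π / (2 * (n : ℝ) + 1) := by linarith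
      have key : ∀ a : ℝ, 0 < a → a ≤ n - 1 → 0 < a * δ ∧ a * δ < π / 2 := fun a ha han =>
        ⟨mul_pos ha hl, mul_lt_of_le_div hu ha.le (by linarith) (by nlinarith)⟩
      have h₁ := mul_lt_of_le_div (a := 1) (b := π / 6) hu (by norm_num) (by linarith)
        (by nlinarith)
      refine ⟨⟨by linarith, by linarith⟩, by omega, fun _ => ⟨key _ (by linarith)
        le_rfl, key _ (by linarith) (by linarith)⟩, by omega⟩
    · simp only [h, OfNat.ofNat_ne_zero, OfNat.ofNat_ne_one, if_false] at hθ hβ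
      have hu : 0 < -δ := by
        have : 0 < π / (6 * (n : ℝ) + 3) := div_pos hpi (by linarith)
        linarith
      have hl : -δ ≤ π / (2 * (n : ℝ) + 5) := by linarith
      have key : ∀ a : ℝ, 0 < a → a ≤ n - 1 → -(π / 2) < a * δ ∧ a * δ < 0 := by
        intro a ha han
        have h₁ := mul_lt_of_le_div (b := π / 2) hl ha.le (by linarith) (by nlinarith)
        have h₂ := mul_pos ha hu
        constructor <;> linarith
      have h₁ := mul_lt_of_le_div (a := 1) (b := π / 6) hl (by norm_num) (by linarith)
        (by nlinarith)
      refine ⟨⟨by linarith, by linarith⟩, by omega, by omega, fun _ => ⟨key _ (by linarith)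
        le_rfl, key _ (by linarith) (by linarith)⟩⟩
  clear hθ hβ
  obtain ⟨⟨hl, hu⟩, b0, b1, b2⟩ := bounds
  have hsin : 0 < sin (2 * π / 3 + δ) := sin_pos_of_pos_of_lt_pi (by linarith) (by linarith)
  have hcos : 0 < cos ((2 * π / 3 + δ) / 2) :=
    cos_pos_of_mem_Ioo ⟨by linarith, by linarith⟩
  obtain ⟨k, rfl⟩ : ∃ k, n = k + 3 := ⟨n - 3, by omega⟩
  have e₂ : ((k + 3 : ℕ) : ℤ) - 2 = ((k + 1 : ℕ) : ℤ) := by push_cast; ring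
  have e₃ : ((k + 3 : ℕ) : ℤ) - 3 = (k : ℤ) := by push_cast; ring
  have hS := chebyshev_two_cos_mul_sin S hS0 hS1 hSrec (2 * π / 3 + δ) (k + 1)
  have hD := chebyshev_sub_mul_cos_half S hS0 hS1 hSrec (θ := 2 * π / 3 + δ)
    (by linarith) (by linarith) k
  rw [e₂, e₃]
  rw [show (((k + 1 : ℕ) : ℝ) + 1) * (2 * π / 3 + δ) =
    ((k : ℝ) + 2) * (2 * π / 3) + (((k + 3 : ℕ) : ℝ) - 1) * δ by push_cast; ring] at hS
  rw [show ((k : ℝ) + 3 / 2) * (2 * π / 3 + δ) =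
    ((k : ℝ) + 3 / 2) * (2 * π / 3) + (((k + 3 : ℕ) : ℝ) - 3 / 2) * δ by push_cast; ring] at hD
  generalize (((k + 3 : ℕ) : ℝ) - 1) * δ = x at *
  generalize (((k + 3 : ℕ) : ℝ) - 3 / 2) * δ = z at *
  obtain ⟨m, hm⟩ : ∃ m, k + 3 = 3 * m + (k + 3) % 3 := ⟨(k + 3) / 3, by omega⟩
  have hm' : (k : ℝ) + 3 = 3 * m + ((k + 3) % 3 : ℕ) := by exact_mod_cast hm
  obtain h | h | h : (k + 3) % 3 = 0 ∨ (k + 3) % 3 = 1 ∨ (k + 3) % 3 = 2 := by omega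
  · obtain ⟨⟨hx₁, hx₂⟩, hz₁, hz₂⟩ := b0 h
    rw [h, Nat.cast_zero] at hm'
    have hk : (k : ℝ) = 3 * m - 3 := by linarith
    rw [hk, show (3 * (m : ℝ) - 3 + 2) * (2 * π / 3) + x = (x - 2 * π / 3) + m * (2 * π) by ring,
      sin_add_nat_mul_two_pi] at hS
    rw [hk, show (3 * (m : ℝ) - 3 + 3 / 2) * (2 * π / 3) + z = (z - π) + m * (2 * π) by ring,
      cos_add_nat_mul_two_pi] at hD
    rw [cos_sub_pi] at hD
    have hs : sin (x - 2 * π / 3) < 0 := sin_neg_of_neg_of_neg_pi_lt (by linarith) (by linarith)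
    have hc : 0 < cos z := cos_pos_of_mem_Ioo ⟨by linarith, by linarith⟩
    exact ⟨fun _ => ⟨neg_of_mul_neg_left (hS ▸ hs) hsin.le,
      neg_of_mul_neg_left (by rw [hD]; linarith) hcos.le⟩, by omega⟩
  · obtain ⟨⟨hx₁, hx₂⟩, hz₁, hz₂⟩ := b1 h
    rw [h] at hm'
    push_cast at hm'
    have hk : (k : ℝ) = 3 * m - 2 := by linarith
    rw [hk, show (3 * (m : ℝ) - 2 + 2) * (2 * π / 3) + x = x + m * (2 * π) by ring,
      sin_add_nat_mul_two_pi] at hS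
    rw [hk, show (3 * (m : ℝ) - 2 + 3 / 2) * (2 * π / 3) + z = (z - π / 3) + m * (2 * π) by ring,
      cos_add_nat_mul_two_pi] at hD
    have hs : 0 < sin x := sin_pos_of_pos_of_lt_pi (by linarith) (by linarith)
    have hc : 0 < cos (z - π / 3) := cos_pos_of_mem_Ioo ⟨by linarith, by linarith⟩
    exact ⟨by omega, fun _ => ⟨pos_of_mul_pos_left (hS ▸ hs) hsin.le,
      pos_of_mul_pos_left (hD ▸ hc) hcos.le⟩⟩
  · obtain ⟨⟨hx₁, hx₂⟩, hz₁, hz₂⟩ := b2 h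
    rw [h] at hm'
    push_cast at hm'
    have hk : (k : ℝ) = 3 * m - 1 := by linarith
    rw [hk, show (3 * (m : ℝ) - 1 + 2) * (2 * π / 3) + x = (x + 2 * π / 3) + m * (2 * π) by ring,
      sin_add_nat_mul_two_pi] at hS
    rw [hk, show (3 * (m : ℝ) - 1 + 3 / 2) * (2 * π / 3) + z = (z + π / 3) + m * (2 * π) by ring,
      cos_add_nat_mul_two_pi] at hD
    have hs : 0 < sin (x + 2 * π / 3) := sin_pos_of_pos_of_lt_pi (by linarith) (by linarith)
    have hc : 0 < cos (z + π / 3) := cos_pos_of_mem_Ioo ⟨by linarith, by linarith⟩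
    exact ⟨by omega, fun _ => ⟨pos_of_mul_pos_left (hS ▸ hs) hsin.le,
      pos_of_mul_pos_left (hD ▸ hc) hcos.le⟩⟩
end

section
/- Let n ≥ 3 be an integer and assume θ_n ∈ [α_n, γ_n) satisfies F(θ_n) = 0. Writing y = 2cos θ: (1) S_n(y) - S_{n-1}(y) ≠ 0 for every θ ∈ [θ_n, β_n), while S_n(2cos β_n) - S_{n-1}(2cos β_n) = 0; (2) S_n(y) + S_{n-1}(y) ≠ 0 for every θ ∈ [θ_n, β_n]. -/
open Real

/-- At `2 cos θ`, consecutive Chebyshev polynomials of the second kind satisfy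
`(S n - S (n-1)) cos (θ/2) = cos ((2n+1)θ/2)` and `(S n + S (n-1)) sin (θ/2) = sin ((2n+1)θ/2)`. -/
lemma chebyshev_half_angle (S : ℤ → ℝ → ℝ)
    (hS0 : ∀ y : ℝ, S 0 y = 1) (hS1 : ∀ y : ℝ, S 1 y = y)
    (hSrec : ∀ (k : ℤ) (y : ℝ), S k y = y * S (k - 1) y - S (k - 2) y) (θ : ℝ) (n : ℕ) :
    (S (n : ℤ) (2 * cos θ) - S ((n : ℤ) - 1) (2 * cos θ)) * cos (θ / 2)
        = cos ((2 * (n : ℝ) + 1) * θ / 2) ∧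
    (S (n : ℤ) (2 * cos θ) + S ((n : ℤ) - 1) (2 * cos θ)) * sin (θ / 2)
        = sin ((2 * (n : ℝ) + 1) * θ / 2) := by
  have hneg : S (-1) (2 * cos θ) = 0 := by
    have h := hSrec 1 (2 * cos θ)
    norm_num [hS0, hS1] at h
    linarith
  induction n using Nat.twoStepInduction with
  | zero => simp [hS0, hneg]
  | one =>
    have hθ : cos θ = 2 * cos (θ / 2) ^ 2 - 1 := by rw [← cos_two_mul]; ring_nf
    have h3 : (2 * ((1 : ℕ) : ℝ) + 1) * θ / 2 = 3 * (θ / 2) := by push_cast; ring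
    rw [h3, cos_three_mul, sin_three_mul]
    norm_num [hS0, hS1]
    rw [hθ]
    constructor
    · ring
    · linear_combination (4 * sin (θ / 2)) * sin_sq_add_cos_sq (θ / 2)
  | more n ih₀ ih₁ =>
    have e₀ := hSrec ((n : ℤ) + 2) (2 * cos θ)
    have e₁ := hSrec ((n : ℤ) + 1) (2 * cos θ)
    have hc : cos ((2 * ((n + 2 : ℕ) : ℝ) + 1) * θ / 2)
        = 2 * cos θ * cos ((2 * ((n + 1 : ℕ) : ℝ) + 1) * θ / 2)
          - cos ((2 * (n : ℝ) + 1) * θ / 2) := by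
      have a : (2 * ((n + 2 : ℕ) : ℝ) + 1) * θ / 2
          = (2 * ((n + 1 : ℕ) : ℝ) + 1) * θ / 2 + θ := by push_cast; ring
      have b : (2 * (n : ℝ) + 1) * θ / 2
          = (2 * ((n + 1 : ℕ) : ℝ) + 1) * θ / 2 - θ := by push_cast; ring
      rw [a, b, cos_add, cos_sub]; ring
    have hs : sin ((2 * ((n + 2 : ℕ) : ℝ) + 1) * θ / 2)
        = 2 * cos θ * sin ((2 * ((n + 1 : ℕ) : ℝ) + 1) * θ / 2)
          - sin ((2 * (n : ℝ) + 1) * θ / 2) := by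
      have a : (2 * ((n + 2 : ℕ) : ℝ) + 1) * θ / 2
          = (2 * ((n + 1 : ℕ) : ℝ) + 1) * θ / 2 + θ := by push_cast; ring
      have b : (2 * (n : ℝ) + 1) * θ / 2
          = (2 * ((n + 1 : ℕ) : ℝ) + 1) * θ / 2 - θ := by push_cast; ring
      rw [a, b, sin_add, sin_sub]; ring
    rw [hc, hs, ← ih₀.1, ← ih₁.1, ← ih₀.2, ← ih₁.2]
    have i₁ : ((n + 2 : ℕ) : ℤ) = (n : ℤ) + 2 := by push_cast; ring
    have i₂ : ((n + 1 : ℕ) : ℤ) = (n : ℤ) + 1 := by push_cast; ring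
    have i₃ : (n : ℤ) + 2 - 1 = n + 1 := by ring
    have i₄ : (n : ℤ) + 2 - 2 = n := by ring
    have i₅ : (n : ℤ) + 1 - 1 = n := by ring
    have i₆ : (n : ℤ) + 1 - 2 = n - 1 := by ring
    rw [i₃, i₄] at e₀
    rw [i₅, i₆] at e₁
    rw [i₁, i₂, i₃, i₅]
    constructor
    · linear_combination cos (θ / 2) * (e₀ - e₁)
    · linear_combination sin (θ / 2) * (e₀ + e₁)

/-- Multiplication by `(2n+1)/2` sends `[α_n, β_n]` into `(jπ, jπ + π/2]` for some `j`, with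
`β_n` going to the right endpoint. -/
lemma exists_phase (n : ℕ) (hn : 3 ≤ n) :
    ∃ j : ℕ, j * π < (2 * (n : ℝ) + 1) * alphaN n / 2 ∧
      (2 * (n : ℝ) + 1) * betaN n / 2 = j * π + π / 2 := by
  have hπ := pi_pos
  have hn' : (3 : ℝ) ≤ n := by exact_mod_cast hn
  have h3 : n % 3 = 0 ∨ n % 3 = 1 ∨ n % 3 = 2 := by omega
  have hk : (n : ℝ) = 3 * ((n / 3 : ℕ) : ℝ) + ((n % 3 : ℕ) : ℝ) := by
    exact_mod_cast (Nat.div_add_mod n 3).symm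
  rcases h3 with h | h | h <;> rw [h] at hk <;> push_cast at hk
  · refine ⟨2 * (n / 3), ?_, ?_⟩ <;> simp only [alphaN, betaN, h] <;> norm_num
    · have hq : 0 < π / (6 * (n : ℝ) + 15) := by positivity
      have hq' : π / (6 * (n : ℝ) + 15) * (6 * n + 15) = π := by field_simp
      set q := π / (6 * (n : ℝ) + 15)
      have hkπ : π * n = π * (3 * ((n / 3 : ℕ) : ℝ) + 0) := by rw [← hk]
      linarith
    · field_simp
      linear_combination 12 * (2 * (n : ℝ) + 1) * hk
  · refine ⟨2 * (n / 3) + 1, ?_, ?_⟩ <;> simp only [alphaN, betaN, h] <;> norm_num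
    · have hp : 0 < 6 * (n : ℝ) - 3 := by linarith
      have hq : 0 < π / (6 * (n : ℝ) - 3) := by positivity
      have hq' : π / (6 * (n : ℝ) - 3) * (6 * n - 3) = π := by field_simp
      set q := π / (6 * (n : ℝ) - 3)
      have hkπ : π * n = π * (3 * ((n / 3 : ℕ) : ℝ) + 1) := by rw [← hk]
      linarith
    · field_simp
      linear_combination 4 * hk
  · refine ⟨2 * (n / 3) + 1, ?_, ?_⟩ <;> simp only [alphaN, betaN, h] <;> norm_num
    · have hq : 0 < π / (2 * (n : ℝ) + 5) := by positivity
      have hq' : π / (2 * (n : ℝ) + 5) * (2 * n + 5) = π := by field_simp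
      set q := π / (2 * (n : ℝ) + 5)
      have hkπ : π * n = π * (3 * ((n / 3 : ℕ) : ℝ) + 2) := by rw [← hk]
      linarith
    · field_simp
      linear_combination 12 * (2 * (n : ℝ) + 1) * hk

lemma betaN_mem_Ioo (n : ℕ) (hn : 3 ≤ n) : betaN n ∈ Set.Ioo 0 π := by
  have hπ := pi_pos
  have hn' : (3 : ℝ) ≤ n := by exact_mod_cast hn
  have h₁ : π / (6 * (n : ℝ) + 3) ≤ π / 7 := by gcongr; linarith
  have h₂ : π / (2 * (n : ℝ) + 1) ≤ π / 7 := by gcongr; linarith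
  have h₃ : 0 < π / (6 * (n : ℝ) + 3) := by positivity
  have h₄ : 0 < π / (2 * (n : ℝ) + 1) := by positivity
  unfold betaN
  split_ifs <;> constructor <;> linarith

/-- Lemma `Sn`. Let `S k` be the Chebyshev polynomials of the second
kind (`S 0 y = 1`, `S 1 y = y`, `S k y = y * S (k-1) y - S (k-2) y` for all integers `k`).
Let `n ≥ 3` and `θ_n ∈ [α_n, γ_n)` with `F(θ_n) = 0`. Writing `y = 2 cos θ`:
(1) `S n y - S (n-1) y ≠ 0` for every `θ ∈ [θ_n, β_n)`, while it vanishes at `θ = β_n`;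
(2) `S n y + S (n-1) y ≠ 0` for every `θ ∈ [θ_n, β_n]`. -/
theorem Sn_nonvanishing
    (S : ℤ → ℝ → ℝ)
    (hS0 : ∀ y : ℝ, S 0 y = 1)
    (hS1 : ∀ y : ℝ, S 1 y = y)
    (hSrec : ∀ (k : ℤ) (y : ℝ), S k y = y * S (k - 1) y - S (k - 2) y)
    (n : ℕ) (hn : 3 ≤ n)
    (θn : ℝ) (hθn : θn ∈ Set.Ico (alphaN n) (gammaN n)) (hFθn : FN n θn = 0) :
    (∀ θ ∈ Set.Ico θn (betaN n),
      S (n : ℤ) (2 * Real.cos θ) - S ((n : ℤ) - 1) (2 * Real.cos θ) ≠ 0) ∧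
    (S (n : ℤ) (2 * Real.cos (betaN n)) - S ((n : ℤ) - 1) (2 * Real.cos (betaN n)) = 0) ∧
    (∀ θ ∈ Set.Icc θn (betaN n),
      S (n : ℤ) (2 * Real.cos θ) + S ((n : ℤ) - 1) (2 * Real.cos θ) ≠ 0) := by
  obtain ⟨j, hα, hβ⟩ := exists_phase n hn
  have hid := fun θ ↦ chebyshev_half_angle S hS0 hS1 hSrec θ n
  have hm : (0 : ℝ) < 2 * n + 1 := by positivity
  have hlow : ∀ θ, θn ≤ θ → j * π < (2 * (n : ℝ) + 1) * θ / 2 := fun θ hθ ↦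
    hα.trans_le (by have := hθn.1.trans hθ; gcongr)
  refine ⟨fun θ hθ h ↦ ?_, ?_, fun θ hθ h ↦ ?_⟩
  · have hl := hlow θ hθ.1
    have hu : (2 * (n : ℝ) + 1) * θ / 2 < j * π + π / 2 := by
      have := hθ.2
      rw [← hβ]
      gcongr
    have hc : 0 < cos ((2 * (n : ℝ) + 1) * θ / 2 - j * π) :=
      cos_pos_of_mem_Ioo ⟨by linarith [pi_pos], by linarith⟩
    rw [cos_sub_nat_mul_pi, ← (hid θ).1, h] at hc
    simp at hc
  · obtain ⟨h0, hπ⟩ := betaN_mem_Ioo n hn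
    have hc : 0 < cos (betaN n / 2) := cos_pos_of_mem_Ioo ⟨by linarith, by linarith⟩
    have h := (hid (betaN n)).1
    rw [hβ, add_comm, cos_add_nat_mul_pi, cos_pi_div_two, mul_zero] at h
    exact (mul_eq_zero.mp h).resolve_right hc.ne'
  · have hl := hlow θ hθ.1
    have hu : (2 * (n : ℝ) + 1) * θ / 2 ≤ j * π + π / 2 := by
      have := hθ.2
      rw [← hβ]
      gcongr
    have hs : 0 < sin ((2 * (n : ℝ) + 1) * θ / 2 - j * π) :=
      sin_pos_of_pos_of_lt_pi (by linarith) (by linarith [pi_pos])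
    rw [sin_sub_nat_mul_pi, ← (hid θ).2, h] at hs
    simp at hs
end

section
/- Let n ≥ 3 be an integer with n ≠ 4, and assume θ_n ∈ [α_n, γ_n) satisfies F(θ_n) = 0. Then for every θ ∈ [θ_n, β_n], writing y = 2cos θ, one has S_{n-1}(y)² + (S_{n-1}(y) - S_{n-2}(y)) * S_{n-2}(y)³ < 0. -/
open Real

lemma cube_bounds_sin {x : ℝ} (h0 : 0 ≤ x) (h1 : x ≤ 1) :
    x - x ^ 3 / 6 - x ^ 5 / 100 ≤ sin x ∧ sin x ≤ x - x ^ 3 / 6 + x ^ 5 / 100 := by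
  have h := Real.sin_bound (x := x) (by rwa [abs_of_nonneg h0])
  rw [abs_of_nonneg h0, abs_le] at h
  constructor <;> linarith [h.1, h.2]

lemma sqrt_two_half_le_sin {x : ℝ} (h0 : π / 4 ≤ x) (h1 : x ≤ 3 * π / 4) : 0.7 ≤ sin x := by
  have h2 : (1.4 : ℝ) ≤ √2 := Real.le_sqrt_of_sq_le (by norm_num)
  have h3 : sin (π / 4) ≤ sin x := by
    rcases le_total x (π / 2) with h | h
    · exact sin_le_sin_of_le_of_le_pi_div_two (by linarith [pi_pos]) h h0
    · rw [← sin_pi_sub x]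
      exact sin_le_sin_of_le_of_le_pi_div_two (by linarith [pi_pos]) (by linarith) (by linarith)
  rw [sin_pi_div_four] at h3
  linarith

/-- Up to sign, `FN n θ` with `θ = 2π/3 + φ` and `n θ ≡ u` modulo `π`. -/
lemma F_core_neg {u φ : ℝ} (hu : -(π / 6) ≤ u) (hu' : u ≤ -0.29) (hφ : -(π / 15) ≤ φ)
    (hφu : 7 * φ ≤ u + π / 3) :
    cos (u - (π / 3 - 5 * φ / 2)) + 2 * sin u * sin (π / 3 + φ / 2) < 0 := by
  have hp := Real.pi_gt_d4
  have hp' := Real.pi_lt_d4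
  obtain ⟨hs, -⟩ := cube_bounds_sin (x := 0.29) (by norm_num) (by norm_num)
  have hx : sin 0.29 ≤ sin (-u) :=
    sin_le_sin_of_le_of_le_pi_div_two (by linarith) (by linarith) (by linarith)
  rw [sin_neg] at hx
  have hx' : sin u ≤ -0.2855 := by norm_num at hs; norm_num at hx ⊢; linarith
  have hc : cos (u - (π / 3 - 5 * φ / 2)) = sin (π / 6 + 5 * φ / 2 + u) := by
    rw [← sin_pi_div_two_sub, ← sin_pi_sub]; congr 1; ring
  rw [hc]
  rcases le_total 0 φ with h | h
  · have h1 : sin (π / 6 + 5 * φ / 2 + u) ≤ sin 0.5042 :=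
      sin_le_sin_of_le_of_le_pi_div_two (by linarith) (by linarith) (by linarith)
    obtain ⟨-, h2⟩ := cube_bounds_sin (x := 0.5042) (by norm_num) (by norm_num)
    have h3 : sin (π / 3) ≤ sin (π / 3 + φ / 2) :=
      sin_le_sin_of_le_of_le_pi_div_two (by linarith) (by linarith) (by linarith)
    rw [sin_pi_div_three] at h3
    have h4 : (1.732 : ℝ) ≤ √3 := Real.le_sqrt_of_sq_le (by norm_num)
    norm_num at h1 h2 h4 hx'
    nlinarith
  · have h1 : sin (π / 6 + 5 * φ / 2 + u) ≤ sin 0.234 :=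
      sin_le_sin_of_le_of_le_pi_div_two (by linarith) (by linarith) (by linarith)
    have h2 : sin 0.234 ≤ 0.234 := sin_le (by norm_num)
    have h3 := sqrt_two_half_le_sin (x := π / 3 + φ / 2) (by linarith) (by linarith)
    nlinarith

/-- The target inequality multiplied by `sin θ ^ 4`, for `θ = 2π/3 + φ` and `n θ ≡ u` modulo `π`. -/
lemma G_core_pos {u φ : ℝ} (hu : -0.29 ≤ u) (hu' : u ≤ 2 * π / 11) (hφ : -(π / 15) ≤ φ)
    (hφ' : φ ≤ π / 15) (hφu : u < 0 → 7 * φ ≤ u + π / 3) :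
    sin u ^ 2 * sin (2 * π / 3 + φ) ^ 2 <
      (sin u + sin (u + π / 3 - φ)) * sin (u + π / 3 - φ) ^ 3 := by
  have hp := Real.pi_gt_d4
  have hp' := Real.pi_lt_d4
  have hS1 : sin (2 * π / 3 + φ) ^ 2 ≤ 1 := sin_sq_le_one _
  rcases le_or_gt 0 u with h | h
  · have hB := sqrt_two_half_le_sin (x := u + π / 3 - φ) (by linarith) (by linarith)
    have hx0 : 0 ≤ sin u := sin_nonneg_of_nonneg_of_le_pi h (by linarith)
    have hx1 : sin u ≤ 0.572 := (sin_le h).trans (by linarith)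
    generalize sin (u + π / 3 - φ) = B at *
    generalize sin u = x at *
    have h3 : (0.343 : ℝ) ≤ B ^ 3 := by
      calc (0.343 : ℝ) = 0.7 ^ 3 := by norm_num
        _ ≤ B ^ 3 := by gcongr
    calc x ^ 2 * sin (2 * π / 3 + φ) ^ 2 ≤ x ^ 2 * 1 := by gcongr
      _ < (x + 0.7) * 0.343 := by nlinarith
      _ ≤ (x + B) * B ^ 3 := by gcongr
  · have hφu := hφu h
    have hx0 : 0 ≤ sin (-u) := sin_nonneg_of_nonneg_of_le_pi (by linarith) (by linarith)
    have hx1 : sin (-u) ≤ sin 0.29 :=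
      sin_le_sin_of_le_of_le_pi_div_two (by linarith) (by linarith) (by linarith)
    obtain ⟨-, hs⟩ := cube_bounds_sin (x := 0.29) (by norm_num) (by norm_num)
    have hx1' : sin (-u) ≤ 0.2864 := by
      refine (hx1.trans hs).trans ?_
      norm_num
    have hxu : sin u = -sin (-u) := by rw [sin_neg, neg_neg]
    rw [hxu]
    generalize sin (-u) = x at *
    rcases le_total 0 φ with h0 | h0
    · have hB : sin 0.649 ≤ sin (u + π / 3 - φ) :=
        sin_le_sin_of_le_of_le_pi_div_two (by linarith) (by linarith) (by linarith)
      obtain ⟨hs', -⟩ := cube_bounds_sin (x := 0.649) (by norm_num) (by norm_num)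
      have hB' : 0.594 ≤ sin (u + π / 3 - φ) := by
        refine le_trans ?_ (hs'.trans hB)
        norm_num
      have hS : sin (2 * π / 3 + φ) ^ 2 ≤ 3 / 4 := by
        have e : sin (2 * π / 3 + φ) = sin (π / 3 - φ) := by
          rw [← sin_pi_sub]; congr 1; ring
        have h1 : sin (π / 3 - φ) ≤ sin (π / 3) :=
          sin_le_sin_of_le_of_le_pi_div_two (by linarith) (by linarith) (by linarith)
        have h2 : 0 ≤ sin (π / 3 - φ) :=
          sin_nonneg_of_nonneg_of_le_pi (by linarith) (by linarith)
        have h3 : sin (π / 3) ^ 2 = 3 / 4 := sq_sin_pi_div_three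
        rw [e, ← h3]
        gcongr
      generalize sin (u + π / 3 - φ) = B at *
      calc (-x) ^ 2 * sin (2 * π / 3 + φ) ^ 2 = x ^ 2 * sin (2 * π / 3 + φ) ^ 2 := by ring
        _ ≤ 0.2864 ^ 2 * (3 / 4) := by gcongr
        _ < (-0.2864 + 0.594) * 0.594 ^ 3 := by norm_num
        _ ≤ (-x + B) * B ^ 3 := by
          gcongr
          linarith
    · have hB : sin 0.75 ≤ sin (u + π / 3 - φ) :=
        sin_le_sin_of_le_of_le_pi_div_two (by linarith) (by linarith) (by linarith)
      obtain ⟨hs', -⟩ := cube_bounds_sin (x := 0.75) (by norm_num) (by norm_num)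
      have hB' : 0.66 ≤ sin (u + π / 3 - φ) := by
        refine le_trans ?_ (hs'.trans hB)
        norm_num
      generalize sin (u + π / 3 - φ) = B at *
      calc (-x) ^ 2 * sin (2 * π / 3 + φ) ^ 2 = x ^ 2 * sin (2 * π / 3 + φ) ^ 2 := by ring
        _ ≤ 0.2864 ^ 2 * 1 := by gcongr
        _ < (-0.2864 + 0.66) * 0.66 ^ 3 := by norm_num
        _ ≤ (-x + B) * B ^ 3 := by
          gcongr
          linarith

lemma chebyshev_mul_sin {S : ℤ → ℝ → ℝ} (hS0 : ∀ y, S 0 y = 1) (hS1 : ∀ y, S 1 y = y)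
    (hSrec : ∀ (k : ℤ) (y : ℝ), S k y = y * S (k - 1) y - S (k - 2) y) (θ : ℝ) (k : ℕ) :
    S k (2 * cos θ) * sin θ = sin ((k + 1) * θ) := by
  induction k using Nat.twoStepInduction with
  | zero => simp [hS0]
  | one => rw [Nat.cast_one, hS1]; norm_num [sin_two_mul]; ring
  | more k ih1 ih2 =>
    rw [hSrec, show ((k + 2 : ℕ) : ℤ) - 1 = (k + 1 : ℕ) by push_cast; ring,
      show ((k + 2 : ℕ) : ℤ) - 2 = k by push_cast; ring, sub_mul, mul_assoc, ih1, ih2]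
    push_cast
    have h1 : ((k : ℝ) + 2 + 1) * θ = (k + 1 + 1) * θ + θ := by ring
    have h2 : ((k : ℝ) + 1) * θ = (k + 1 + 1) * θ - θ := by ring
    rw [h1, h2, sin_add, sin_sub]
    ring

lemma FN_eq {n : ℕ} {u φ e : ℝ} (hs : sin (n * (2 * π / 3 + φ)) = e * sin u)
    (hc : cos (n * (2 * π / 3 + φ)) = e * cos u) :
    FN n (2 * π / 3 + φ) =
      e * (cos (u - (π / 3 - 5 * φ / 2)) + 2 * sin u * sin (π / 3 + φ / 2)) := by
  have hadd (x : ℝ) : cos (n * (2 * π / 3 + φ) + x) = e * cos (u + x) := by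
    rw [cos_add, hs, hc, cos_add]; ring
  have h1 : ((n : ℝ) + 1) * (2 * π / 3 + φ) = n * (2 * π / 3 + φ) + (2 * π / 3 + φ) := by ring
  have h2 : (2 * (n : ℝ) + 1) * (2 * π / 3 + φ) / 2
      = n * (2 * π / 3 + φ) + (π / 3 + φ / 2) := by ring
  have h3 : 2 * cos (u + (2 * π / 3 + φ)) * cos (3 * (2 * π / 3 + φ) / 2)
      = cos (u + (2 * π / 3 + φ) - 3 * (2 * π / 3 + φ) / 2)
        + cos (u + (2 * π / 3 + φ) + 3 * (2 * π / 3 + φ) / 2) := by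
    rw [cos_sub _ (3 * _ / 2), cos_add _ (3 * _ / 2)]; ring
  have h4 : u + (2 * π / 3 + φ) - 3 * (2 * π / 3 + φ) / 2 = u - (π / 3 + φ / 2) := by ring
  have h5 : cos (u + (2 * π / 3 + φ) + 3 * (2 * π / 3 + φ) / 2)
      = cos (u - (π / 3 - 5 * φ / 2)) := by
    rw [← cos_sub_two_pi]; congr 1; ring
  rw [h4, h5] at h3
  rw [FN, h1, h2, hadd, hadd]
  calc _ = e * (2 * cos (u + (2 * π / 3 + φ)) * cos (3 * (2 * π / 3 + φ) / 2)
        - cos (u + (π / 3 + φ / 2))) := by ring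
    _ = _ := by rw [h3, cos_sub u (π / 3 + φ / 2), cos_add u (π / 3 + φ / 2)]; ring

lemma chebyshev_expr_neg {S : ℤ → ℝ → ℝ} (hS0 : ∀ y, S 0 y = 1) (hS1 : ∀ y, S 1 y = y)
    (hSrec : ∀ (k : ℤ) (y : ℝ), S k y = y * S (k - 1) y - S (k - 2) y)
    {n : ℕ} (hn : 2 ≤ n) {u θ e : ℝ} (he : e ^ 2 = 1) (hθ : sin θ ≠ 0)
    (hs : sin (n * θ) = e * sin u) (hc : cos (n * θ) = e * cos u)
    (hG : sin u ^ 2 * sin θ ^ 2 < (sin u + sin (θ - u)) * sin (θ - u) ^ 3) :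
    S ((n : ℤ) - 1) (2 * cos θ) ^ 2 +
        (S ((n : ℤ) - 1) (2 * cos θ) - S ((n : ℤ) - 2) (2 * cos θ)) *
          S ((n : ℤ) - 2) (2 * cos θ) ^ 3 < 0 := by
  obtain ⟨m, rfl⟩ : ∃ m, n = m + 2 := ⟨n - 2, by omega⟩
  have ha := chebyshev_mul_sin hS0 hS1 hSrec θ (m + 1)
  have hb := chebyshev_mul_sin hS0 hS1 hSrec θ m
  rw [show (((m + 1 : ℕ) : ℝ) + 1) * θ = (m + 2 : ℕ) * θ by push_cast; ring, hs] at ha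
  rw [show ((m : ℝ) + 1) * θ = (m + 2 : ℕ) * θ - θ by push_cast; ring, sin_sub, hs, hc] at hb
  rw [show ((m + 2 : ℕ) : ℤ) - 1 = (m + 1 : ℕ) by push_cast; ring,
    show ((m + 2 : ℕ) : ℤ) - 2 = m by push_cast; ring]
  generalize S ((m + 1 : ℕ) : ℤ) (2 * cos θ) = A at *
  generalize S (m : ℤ) (2 * cos θ) = B at *
  have hb' : B * sin θ = -e * sin (θ - u) := by rw [hb, sin_sub]; ring
  have hpos : 0 < sin θ ^ 4 := by positivity
  have key : (A ^ 2 + (A - B) * B ^ 3) * sin θ ^ 4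
      = sin u ^ 2 * sin θ ^ 2 - (sin u + sin (θ - u)) * sin (θ - u) ^ 3 := by
    calc _ = (A * sin θ) ^ 2 * sin θ ^ 2 + (A * sin θ - B * sin θ) * (B * sin θ) ^ 3 := by ring
      _ = e ^ 2 * (sin u ^ 2 * sin θ ^ 2
          - e ^ 2 * ((sin u + sin (θ - u)) * sin (θ - u) ^ 3)) := by rw [ha, hb']; ring
      _ = _ := by rw [he]; ring
  by_contra! hcon
  have := mul_nonneg hcon hpos.le
  linarith

/-- The residue-independent argument: `c` is the multiple of `π` nearest to `2πn/3`. -/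
lemma chebyshev_expr_neg_of_root {S : ℤ → ℝ → ℝ} (hS0 : ∀ y, S 0 y = 1) (hS1 : ∀ y, S 1 y = y)
    (hSrec : ∀ (k : ℤ) (y : ℝ), S k y = y * S (k - 1) y - S (k - 2) y)
    {n : ℕ} (hn : 2 ≤ n) {c θn θ : ℝ} (k : ℤ) (hc : c = k * π) (hF : FN n θn = 0) (hle : θn ≤ θ)
    (hun : -(π / 6) ≤ n * θn - c) (hφn : -(π / 15) ≤ θn - 2 * π / 3)
    (hφ : θ - 2 * π / 3 ≤ π / 15) (hu : n * θ - c ≤ 2 * π / 11)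
    (hlin : ∀ t, θn ≤ t → t ≤ θ → n * t - c < 0 → 7 * (t - 2 * π / 3) ≤ n * t - c + π / 3) :
    S ((n : ℤ) - 1) (2 * cos θ) ^ 2 +
        (S ((n : ℤ) - 1) (2 * cos θ) - S ((n : ℤ) - 2) (2 * cos θ)) *
          S ((n : ℤ) - 2) (2 * cos θ) ^ 3 < 0 := by
  have hpi := pi_pos
  obtain ⟨e, he, hs, hcos⟩ : ∃ e : ℝ, e ^ 2 = 1 ∧ (∀ t : ℝ, sin (n * t) = e * sin (n * t - c)) ∧
      ∀ t : ℝ, cos (n * t) = e * cos (n * t - c) := by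
    have he : ((-1 : ℝ) ^ k) ^ 2 = 1 := by
      rw [← zpow_natCast, ← zpow_mul, mul_comm, zpow_mul]; norm_num
    refine ⟨(-1) ^ k, he, fun t => ?_, fun t => ?_⟩
    · rw [hc, sin_sub_int_mul_pi, ← mul_assoc, ← sq, he, one_mul]
    · rw [hc, cos_sub_int_mul_pi, ← mul_assoc, ← sq, he, one_mul]
  have hun' : -0.29 < n * θn - c := by
    by_contra! h
    have hneg := F_core_neg hun h hφn (hlin θn le_rfl hle (by linarith))
    have hθ : 2 * π / 3 + (θn - 2 * π / 3) = θn := by ring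
    have := FN_eq (n := n) (u := n * θn - c) (φ := θn - 2 * π / 3) (e := e)
      (by rw [hθ]; exact hs θn) (by rw [hθ]; exact hcos θn)
    rw [hθ, hF] at this
    rcases mul_eq_zero.1 this.symm with h0 | h0
    · simp [h0] at he
    · exact hneg.ne h0
  have hmono : (n : ℝ) * θn ≤ n * θ := by gcongr
  have hG := G_core_pos (u := n * θ - c) (φ := θ - 2 * π / 3) (by linarith) hu (by linarith) hφ
    (hlin θ hle le_rfl)
  rw [show 2 * π / 3 + (θ - 2 * π / 3) = θ by ring,
    show n * θ - c + π / 3 - (θ - 2 * π / 3) = π - (θ - (n * θ - c)) by ring, sin_pi_sub] at hG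
  exact chebyshev_expr_neg hS0 hS1 hSrec hn he
    (sin_pos_of_pos_of_lt_pi (by linarith) (by linarith)).ne' (hs θ) (hcos θ) hG

/-- Lemma `lem`. Let `S k` be the Chebyshev polynomials of the second
kind (`S 0 y = 1`, `S 1 y = y`, `S k y = y * S (k-1) y - S (k-2) y` for all integers `k`).
Let `n ≥ 3`, `n ≠ 4`, and `θ_n ∈ [α_n, γ_n)` with `F(θ_n) = 0`. Then for every
`θ ∈ [θ_n, β_n]`, writing `y = 2 cos θ`,
`S (n-1) y ^ 2 + (S (n-1) y - S (n-2) y) * S (n-2) y ^ 3 < 0`. -/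
theorem G_negative_on_interval
    (S : ℤ → ℝ → ℝ)
    (hS0 : ∀ y : ℝ, S 0 y = 1)
    (hS1 : ∀ y : ℝ, S 1 y = y)
    (hSrec : ∀ (k : ℤ) (y : ℝ), S k y = y * S (k - 1) y - S (k - 2) y)
    (n : ℕ) (hn : 3 ≤ n) (hn4 : n ≠ 4)
    (θn : ℝ) (hθn : θn ∈ Set.Ico (alphaN n) (gammaN n)) (hFθn : FN n θn = 0) :
    ∀ θ ∈ Set.Icc θn (betaN n),
      S ((n : ℤ) - 1) (2 * Real.cos θ) ^ 2 +
        (S ((n : ℤ) - 1) (2 * Real.cos θ) - S ((n : ℤ) - 2) (2 * Real.cos θ)) *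
          S ((n : ℤ) - 2) (2 * Real.cos θ) ^ 3 < 0 := by
  rintro θ ⟨hle, hθβ⟩
  have hα := hθn.1
  have hpi := pi_pos
  obtain ⟨m, h⟩ : ∃ m, n = 3 * m ∨ n = 3 * m + 1 ∨ n = 3 * m + 2 := ⟨n / 3, by omega⟩
  have hn2 : 2 ≤ n := by omega
  have hn3 : (3 : ℝ) ≤ n := by exact_mod_cast hn
  rcases h with h | h | h
  · have hmod : n % 3 = 0 := by omega
    rw [alphaN, if_pos hmod] at hα
    rw [betaN, if_pos hmod] at hθβ
    have hnm : (n : ℝ) = 3 * m := by exact_mod_cast h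
    have ha : π / (6 * (n : ℝ) + 15) ≤ π / 15 := by gcongr; linarith
    have hb : π / (6 * (n : ℝ) + 3) ≤ π / 15 := by gcongr; linarith
    have ha' : n * (π / (6 * (n : ℝ) + 15)) ≤ π / 6 := by
      rw [mul_div_assoc', div_le_div_iff₀ (by linarith) (by norm_num)]; nlinarith
    have hb' : n * (π / (6 * (n : ℝ) + 3)) ≤ 2 * π / 11 := by
      rw [mul_div_assoc', div_le_div_iff₀ (by linarith) (by norm_num)]; nlinarith
    have hc (t : ℝ) : n * t - 2 * m * π = n * (t - 2 * π / 3) := by rw [hnm]; ring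
    refine chebyshev_expr_neg_of_root hS0 hS1 hSrec hn2 (c := 2 * m * π) (2 * m)
      (by push_cast; ring) hFθn hle ?_ (by linarith) (by linarith) ?_ ?_
    · rw [hc]; nlinarith
    · rw [hc]; nlinarith
    · intro t ht1 ht2
      rw [hc]
      intro hneg
      have : t - 2 * π / 3 < 0 := by by_contra! h0; nlinarith
      have : n * (t - 2 * π / 3) ≥ -(π / 6) := by nlinarith
      linarith
  · have hmod : n % 3 = 1 := by omega
    have hmod0 : n % 3 ≠ 0 := by omega
    rw [alphaN, if_neg hmod0, if_pos hmod] at hα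
    rw [betaN, if_neg hmod0, if_pos hmod] at hθβ
    have hnm : (n : ℝ) = 3 * m + 1 := by exact_mod_cast h
    have hn7 : (7 : ℝ) ≤ n := by exact_mod_cast (by omega : 7 ≤ n)
    have ha : 0 ≤ π / (6 * (n : ℝ) - 3) := div_nonneg hpi.le (by linarith)
    have hb : π / (2 * (n : ℝ) + 1) ≤ π / 15 := by gcongr; linarith
    have ha' : π / 6 ≤ n * (π / (6 * (n : ℝ) - 3)) := by
      rw [mul_div_assoc', div_le_div_iff₀ (by norm_num) (by linarith)]; nlinarith
    have hb' : n * (π / (2 * (n : ℝ) + 1)) ≤ π / 2 := by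
      rw [mul_div_assoc', div_le_div_iff₀ (by linarith) (by norm_num)]; nlinarith
    have hc (t : ℝ) : n * t - (2 * m + 1) * π = n * (t - 2 * π / 3) - π / 3 := by rw [hnm]; ring
    refine chebyshev_expr_neg_of_root hS0 hS1 hSrec hn2 (c := (2 * m + 1) * π) (2 * m + 1)
      (by push_cast; ring) hFθn hle ?_ (by linarith) (by linarith) ?_ ?_
    · rw [hc]; nlinarith
    · rw [hc]; nlinarith
    · intro t ht1 ht2 _
      rw [hc]
      nlinarith
  · have hmod1 : n % 3 ≠ 1 := by omega
    have hmod0 : n % 3 ≠ 0 := by omega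
    rw [alphaN, if_neg hmod0, if_neg hmod1] at hα
    rw [betaN, if_neg hmod0, if_neg hmod1] at hθβ
    have hnm : (n : ℝ) = 3 * m + 2 := by exact_mod_cast h
    have hn5 : (5 : ℝ) ≤ n := by exact_mod_cast (by omega : 5 ≤ n)
    have ha : π / (2 * (n : ℝ) + 5) ≤ π / 15 := by gcongr; linarith
    have hb : 0 ≤ π / (6 * (n : ℝ) + 3) := by positivity
    have ha' : n * (π / (2 * (n : ℝ) + 5)) ≤ π / 2 := by
      rw [mul_div_assoc', div_le_div_iff₀ (by linarith) (by norm_num)]; nlinarith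
    have hb' : 5 * π / 33 ≤ n * (π / (6 * (n : ℝ) + 3)) := by
      rw [mul_div_assoc', div_le_div_iff₀ (by norm_num) (by linarith)]; nlinarith
    have hc (t : ℝ) : n * t - (2 * m + 1) * π = n * (t - 2 * π / 3) + π / 3 := by rw [hnm]; ring
    refine chebyshev_expr_neg_of_root hS0 hS1 hSrec hn2 (c := (2 * m + 1) * π) (2 * m + 1)
      (by push_cast; ring) hFθn hle ?_ (by linarith) (by linarith) ?_ ?_
    · rw [hc]; nlinarith
    · rw [hc]; nlinarith
    · intro t ht1 ht2 _
      rw [hc]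
      have : n * (t - 2 * π / 3) ≥ -(π / 2) := by nlinarith
      linarith
end

section
/- Let n ≥ 1 be an integer and let t be a complex number with t ∉ {0, 1, -1}, and set y = t + t⁻¹. Then (y - 1)(y² - 3)*S_{n-1}(y) - (y² - y - 1)*S_{n-2}(y) = (t^{2n+5} - t^{2n+3} + t^{2n+2} + t³ - t² + 1)/(t^{n+2}(t + 1)). -/
/-- The Chebyshev recurrence with `s (-1) = 0`, `s (-2) = -1` at `t + t⁻¹`, solved in powers of `t`
for two consecutive indices. -/
theorem chebyshev_closed_form {K : Type*} [Field K] (s : ℤ → K) {t : K} (ht : t ≠ 0)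
    (h₁ : s (-1) = 0) (h₂ : s (-2) = -1)
    (hrec : ∀ k : ℤ, s k = (t + t⁻¹) * s (k - 1) - s (k - 2)) (n : ℕ) :
    t ^ n * (t ^ 2 - 1) * s ((n : ℤ) - 1) = t * (t ^ (2 * n) - 1) ∧
      t ^ n * (t ^ 2 - 1) * s ((n : ℤ) - 2) = t ^ (2 * n) - t ^ 2 := by
  induction n with
  | zero => simp [h₁, h₂]
  | succ n ih =>
    obtain ⟨ih₁, ih₂⟩ := ih
    have e₁ : ((n + 1 : ℕ) : ℤ) - 1 = n := by push_cast; ring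
    have e₂ : ((n + 1 : ℕ) : ℤ) - 2 = n - 1 := by push_cast; ring
    have hinv : t * t⁻¹ = 1 := mul_inv_cancel₀ ht
    rw [e₁, e₂]
    constructor
    · rw [hrec n]
      linear_combination (t ^ 2 + 1) * ih₁ - t * ih₂ +
        t ^ n * (t ^ 2 - 1) * s ((n : ℤ) - 1) * hinv
    · linear_combination t * ih₁

/-- Let `S k` be the Chebyshev polynomials of the second kind
(`S 0 y = 1`, `S 1 y = y`, `S k y = y * S (k-1) y - S (k-2) y` for all integers `k`).
Let `n ≥ 1` be an integer, `t` a complex number with `t ∉ {0, 1, -1}`, and `y = t + t⁻¹`.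
Then `(y - 1)(y² - 3) S (n-1) y - (y² - y - 1) S (n-2) y
  = (t^{2n+5} - t^{2n+3} + t^{2n+2} + t³ - t² + 1) / (t^{n+2} (t + 1))`. -/
theorem chebyshev_alexander_identity
    (S : ℤ → ℂ → ℂ)
    (hS0 : ∀ y : ℂ, S 0 y = 1)
    (hS1 : ∀ y : ℂ, S 1 y = y)
    (hSrec : ∀ (k : ℤ) (y : ℂ), S k y = y * S (k - 1) y - S (k - 2) y)
    (n : ℕ) (hn : 1 ≤ n)
    (t : ℂ) (ht0 : t ≠ 0) (ht1 : t ≠ 1) (ht2 : t ≠ -1)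
    (y : ℂ) (hy : y = t + t⁻¹) :
    (y - 1) * (y ^ 2 - 3) * S ((n : ℤ) - 1) y - (y ^ 2 - y - 1) * S ((n : ℤ) - 2) y
      = (t ^ (2 * n + 5) - t ^ (2 * n + 3) + t ^ (2 * n + 2) + t ^ 3 - t ^ 2 + 1) /
          (t ^ (n + 2) * (t + 1)) := by
  have h₁ : S (-1) y = 0 := by
    have h := hSrec 1 y
    norm_num [hS0, hS1] at h
    linear_combination h
  have h₂ : S (-2) y = -1 := by
    have h := hSrec 0 y
    norm_num [hS0, h₁] at h
    linear_combination h
  obtain ⟨ha, hb⟩ := chebyshev_closed_form (fun k => S k y) ht0 h₁ h₂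
    (fun k => hy ▸ hSrec k y) n
  have hsub : t - 1 ≠ 0 := sub_ne_zero.mpr ht1
  have hadd : t + 1 ≠ 0 := fun h => ht2 (eq_neg_of_add_eq_zero_left h)
  have hcubic : t ^ 3 * ((y - 1) * (y ^ 2 - 3)) = (t ^ 2 - t + 1) * (t ^ 4 - t ^ 2 + 1) := by
    rw [hy]; field_simp; ring
  have hquad : t ^ 2 * (y ^ 2 - y - 1) = t ^ 4 - t ^ 3 + t ^ 2 - t + 1 := by
    rw [hy]; field_simp; ring
  rw [eq_div_iff (mul_ne_zero (pow_ne_zero _ ht0) hadd)]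
  apply mul_left_cancel₀ (mul_ne_zero ht0 hsub)
  linear_combination t ^ 3 * ((y - 1) * (y ^ 2 - 3)) * ha + t * (t ^ (2 * n) - 1) * hcubic -
    t * (t ^ 2 * (y ^ 2 - y - 1)) * hb - t * (t ^ (2 * n) - t ^ 2) * hquad
end

section
/- Let n ≥ 3 be an integer, let θ = β_n and y = 2cos β_n, and define r, z_±, x_± as in the context. Then 1 + r*(S_{n-2}(y) - S_{n-3}(y)) = (1-y)², z_± = ±(1 - y), and x_± = ∓2; in particular x_+ = -2 and x_- = 2. -/
open Real

theorem chebyshevS_mul_sin (S : ℤ → ℝ → ℝ) (θ : ℝ)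
    (hS0 : S 0 (2 * cos θ) = 1) (hS1 : S 1 (2 * cos θ) = 2 * cos θ)
    (hSrec : ∀ k : ℤ, S k (2 * cos θ) =
      2 * cos θ * S (k - 1) (2 * cos θ) - S (k - 2) (2 * cos θ)) (k : ℕ) :
    S k (2 * cos θ) * sin θ = sin ((k + 1) * θ) := by
  induction k using Nat.twoStepInduction with
  | zero => simp [hS0]
  | one =>
    rw [Nat.cast_one, Nat.cast_one, hS1, one_add_one_eq_two, sin_two_mul]
    ring
  | more k ih₀ ih₁ =>
    have h := hSrec ((k + 2 : ℕ) : ℤ)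
    rw [show ((k + 2 : ℕ) : ℤ) - 1 = ((k + 1 : ℕ) : ℤ) by push_cast; ring,
      show ((k + 2 : ℕ) : ℤ) - 2 = (k : ℤ) by push_cast; ring] at h
    rw [h, sub_mul, mul_assoc, ih₀, ih₁]
    push_cast
    have e₁ : ((k : ℝ) + 2 + 1) * θ = (k + 1 + 1) * θ + θ := by ring
    have e₂ : ((k : ℝ) + 1) * θ = (k + 1 + 1) * θ - θ := by ring
    rw [e₁, e₂, sin_add, sin_sub]
    ring

theorem betaN_bounds (n : ℕ) (hn : 3 ≤ n) : π / 3 < betaN n ∧ betaN n < π := by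
  have hn' : (3 : ℝ) ≤ n := by exact_mod_cast hn
  have hπ := pi_pos
  have h₁ : π / (6 * (n : ℝ) + 3) < π / 3 :=
    div_lt_div_of_pos_left hπ (by norm_num) (by linarith)
  have h₂ : π / (2 * (n : ℝ) + 1) < π / 3 :=
    div_lt_div_of_pos_left hπ (by norm_num) (by linarith)
  have h₃ : 0 < π / (6 * (n : ℝ) + 3) := by positivity
  have h₄ : 0 < π / (2 * (n : ℝ) + 1) := by positivity
  unfold betaN
  split_ifs <;> constructor <;> linarith

theorem betaN_mul_half (n : ℕ) :
    ∃ m : ℕ, (2 * (n : ℝ) + 1) * (betaN n / 2) =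
      (if n % 3 = 0 then π / 2 else -(π / 2)) + m * (2 * π) := by
  have h₁ : (2 * (n : ℝ) + 1) ≠ 0 := by positivity
  have h₂ : (6 * (n : ℝ) + 3) ≠ 0 := by positivity
  have hdiv : (n : ℝ) = 3 * (n / 3 : ℕ) + (n % 3 : ℕ) := by
    exact_mod_cast (Nat.div_add_mod n 3).symm
  have hlt : n % 3 < 3 := Nat.mod_lt _ (by norm_num)
  have e₁ : (2 * (n : ℝ) + 1) * (π / (2 * (n : ℝ) + 1)) = π := mul_div_cancel₀ π h₁
  have e₂ : (2 * (n : ℝ) + 1) * (π / (6 * (n : ℝ) + 3)) = π / 3 := by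
    field_simp
    ring
  unfold betaN
  split_ifs with h0 h1
  · refine ⟨n / 3, ?_⟩
    rw [h0] at hdiv
    push_cast at hdiv
    linear_combination (1 / 2) * e₂ + (2 * π / 3) * hdiv
  · refine ⟨n / 3 + 1, ?_⟩
    rw [h1] at hdiv
    push_cast at hdiv ⊢
    linear_combination (1 / 2) * e₁ + (2 * π / 3) * hdiv
  · refine ⟨n / 3 + 1, ?_⟩
    rw [show n % 3 = 2 by omega] at hdiv
    push_cast at hdiv ⊢
    linear_combination (-1 / 2) * e₂ + (2 * π / 3) * hdiv

theorem cos_sin_betaN_mul_half (n : ℕ) :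
    cos ((2 * (n : ℝ) + 1) * (betaN n / 2)) = 0 ∧
      sin ((2 * (n : ℝ) + 1) * (betaN n / 2)) = if n % 3 = 0 then 1 else -1 := by
  obtain ⟨m, hm⟩ := betaN_mul_half n
  rw [hm, cos_add_nat_mul_two_pi, sin_add_nat_mul_two_pi]
  split_ifs <;> simp

/-- At `y = 2 cos β_n` the values `S (n-1) y` and `S n y` agree. -/
theorem chebyshevS_at_betaN (S : ℤ → ℝ → ℝ)
    (hS0 : ∀ y : ℝ, S 0 y = 1)
    (hS1 : ∀ y : ℝ, S 1 y = y)
    (hSrec : ∀ (k : ℤ) (y : ℝ), S k y = y * S (k - 1) y - S (k - 2) y)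
    (n : ℕ) (hn : 3 ≤ n) :
    S n (2 * cos (betaN n)) * (2 * sin (betaN n / 2)) = (if n % 3 = 0 then 1 else -1) ∧
      S ((n : ℤ) - 1) (2 * cos (betaN n)) * (2 * sin (betaN n / 2)) =
        if n % 3 = 0 then 1 else -1 := by
  obtain ⟨hβ₀, hβ₁⟩ := betaN_bounds n hn
  have hπ := pi_pos
  obtain ⟨hc, hs⟩ := cos_sin_betaN_mul_half n
  have hcos : cos (betaN n / 2) ≠ 0 :=
    (cos_pos_of_mem_Ioo ⟨by linarith, by linarith⟩).ne'
  have hsin : sin (betaN n) = 2 * sin (betaN n / 2) * cos (betaN n / 2) := by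
    rw [← sin_two_mul]
    congr 1
    ring
  have hcheb := chebyshevS_mul_sin S (betaN n) (hS0 _) (hS1 _) (fun k => hSrec k _)
  rw [← hs]
  constructor
  · have h := hcheb n
    rw [show ((n : ℝ) + 1) * betaN n = (2 * n + 1) * (betaN n / 2) + betaN n / 2 by ring,
      sin_add, hc, hsin] at h
    exact mul_right_cancel₀ hcos (by linear_combination h)
  · have h := hcheb (n - 1)
    rw [Nat.cast_sub (by omega), Nat.cast_sub (by omega)] at h
    push_cast at h
    rw [show ((n : ℝ) - 1 + 1) * betaN n = (2 * n + 1) * (betaN n / 2) - betaN n / 2 by ring,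
      sin_sub, hc, hsin] at h
    exact mul_right_cancel₀ hcos (by linear_combination h)

/-- Proposition `x`. Let `S k` be the Chebyshev polynomials of the
second kind (`S 0 y = 1`, `S 1 y = y`, `S k y = y * S (k-1) y - S (k-2) y` for all
integers `k`). Let `n ≥ 3`, `y = 2 cos β_n`,
`r = (S (n-2) y ∓ √(S (n-2) y² + 4))/2` (sign `-` iff `n ≡ 0 (mod 3)`),
`z_± = ± √(1 + r (S (n-2) y - S (n-3) y))` and
`x_± = z_± (y + 1 - (S (n-3) y + r)/S (n-2) y)`. Then
`1 + r (S (n-2) y - S (n-3) y) = (1-y)²`, `z_± = ±(1-y)`, and `x_± = ∓2`. -/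
theorem x_at_beta
    (S : ℤ → ℝ → ℝ)
    (hS0 : ∀ y : ℝ, S 0 y = 1)
    (hS1 : ∀ y : ℝ, S 1 y = y)
    (hSrec : ∀ (k : ℤ) (y : ℝ), S k y = y * S (k - 1) y - S (k - 2) y)
    (n : ℕ) (hn : 3 ≤ n)
    (y r zp zm xp xm : ℝ)
    (hy : y = 2 * Real.cos (betaN n))
    (hr : r = if n % 3 = 0 then
        (S ((n : ℤ) - 2) y - Real.sqrt (S ((n : ℤ) - 2) y ^ 2 + 4)) / 2
      else (S ((n : ℤ) - 2) y + Real.sqrt (S ((n : ℤ) - 2) y ^ 2 + 4)) / 2)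
    (hzp : zp = Real.sqrt (1 + r * (S ((n : ℤ) - 2) y - S ((n : ℤ) - 3) y)))
    (hzm : zm = -Real.sqrt (1 + r * (S ((n : ℤ) - 2) y - S ((n : ℤ) - 3) y)))
    (hxp : xp = zp * (y + 1 - (S ((n : ℤ) - 3) y + r) / S ((n : ℤ) - 2) y))
    (hxm : xm = zm * (y + 1 - (S ((n : ℤ) - 3) y + r) / S ((n : ℤ) - 2) y)) :
    1 + r * (S ((n : ℤ) - 2) y - S ((n : ℤ) - 3) y) = (1 - y) ^ 2 ∧
    zp = 1 - y ∧ zm = -(1 - y) ∧ xp = -2 ∧ xm = 2 := by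
  obtain ⟨hβ₀, hβ₁⟩ := betaN_bounds n hn
  have hπ := pi_pos
  obtain ⟨hA, hB⟩ := chebyshevS_at_betaN S hS0 hS1 hSrec n hn
  rw [← hy] at hA hB
  have hy1 : y < 1 := by
    have h := cos_lt_cos_of_nonneg_of_le_pi (by linarith) hβ₁.le hβ₀
    rw [cos_pi_div_three] at h
    linarith
  have hpos : 0 < 2 * sin (betaN n / 2) := by
    have := sin_pos_of_pos_of_lt_pi (x := betaN n / 2) (by linarith) (by linarith)
    linarith
  have hsq : (2 * sin (betaN n / 2)) ^ 2 = 2 - y := by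
    rw [mul_pow, sin_sq_eq_half_sub, hy, mul_div_cancel₀ _ (two_ne_zero' ℝ)]
    ring
  set σ := 2 * sin (betaN n / 2)
  set s := S ((n : ℤ) - 1) y with hs
  have hSn : S n y = s := mul_right_cancel₀ hpos.ne' (hA.trans hB.symm)
  have hS2 : S ((n : ℤ) - 2) y = (y - 1) * s := by
    linear_combination hSrec n y - hSn
  have hS3 : S ((n : ℤ) - 3) y = (y ^ 2 - y - 1) * s := by
    have h := hSrec ((n : ℤ) - 1) y
    rw [show (n : ℤ) - 1 - 1 = n - 2 by ring, show (n : ℤ) - 1 - 2 = n - 3 by ring, hS2,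
      ← hs] at h
    linear_combination h
  have hs2 : s ^ 2 * (2 - y) = 1 := by
    rw [← hsq, ← mul_pow, hB]
    split_ifs <;> norm_num
  have hs0 : s ≠ 0 := by
    rintro h
    simp [h] at hs2
  have hdisc : S ((n : ℤ) - 2) y ^ 2 + 4 = ((3 - y) * s) ^ 2 := by
    rw [hS2]
    linear_combination -4 * hs2
  have hr' : r = (y - 2) * s := by
    rw [hr, hdisc, sqrt_sq_eq_abs, abs_mul, abs_of_pos (by linarith : 0 < 3 - y), hS2]
    split_ifs at hB ⊢ with h0
    · have : 0 < s := pos_of_mul_pos_left (hB ▸ one_pos) hpos.le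
      rw [abs_of_pos this]
      ring
    · have : s < 0 := by nlinarith
      rw [abs_of_neg this]
      ring
  have hmain : 1 + r * (S ((n : ℤ) - 2) y - S ((n : ℤ) - 3) y) = (1 - y) ^ 2 := by
    rw [hr', hS2, hS3]
    linear_combination y * (y - 2) * hs2
  have hy0 : y - 1 ≠ 0 := by linarith
  have hx : y + 1 - (S ((n : ℤ) - 3) y + r) / S ((n : ℤ) - 2) y = 2 / (y - 1) := by
    rw [hr', hS2, hS3]
    field_simp
    ring
  rw [hmain, sqrt_sq (by linarith)] at hzp hzm
  refine ⟨hmain, hzp, hzm, ?_, ?_⟩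
  · rw [hxp, hzp, hx]
    field_simp
    ring
  · rw [hxm, hzm, hx]
    field_simp
    ring
end

section
/- Let x, y, z be complex numbers and set s = x² + y² + z² - x*y*z - 4, s₂ = x² - 2 - s, s₃ = y*s₂ - (x*z - y), and σ = y + s₂ + s₃. Assume x - x*y + (s+1)*z = 0, and let ξ be a complex number satisfying (ξ - 2 - s₂)*s₂ = σ - s₂ - ξ and (σ + 2 - 2ξ)*s₃ = s₃² - s₃*ξ + σ - 2. Then x*(ξ - x²) = (z - x)*s. -/
/-- Lemma `lr`. Let `x, y, z` be complex numbers and set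
`s = x² + y² + z² - x y z - 4`, `s₂ = x² - 2 - s`, `s₃ = y s₂ - (x z - y)`,
`σ = y + s₂ + s₃`. Assume `x - x y + (s+1) z = 0`, and let `ξ` satisfy
`(ξ - 2 - s₂) s₂ = σ - s₂ - ξ` and `(σ + 2 - 2ξ) s₃ = s₃² - s₃ ξ + σ - 2`.
Then `x (ξ - x²) = (z - x) s`. -/
theorem xi_identity
    (x y z : ℂ)
    (s s₂ s₃ σ : ℂ)
    (hs : s = x ^ 2 + y ^ 2 + z ^ 2 - x * y * z - 4)
    (hs₂ : s₂ = x ^ 2 - 2 - s)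
    (hs₃ : s₃ = y * s₂ - (x * z - y))
    (hσ : σ = y + s₂ + s₃)
    (hQ : x - x * y + (s + 1) * z = 0)
    (ξ : ℂ)
    (hξ1 : (ξ - 2 - s₂) * s₂ = σ - s₂ - ξ)
    (hξ2 : (σ + 2 - 2 * ξ) * s₃ = s₃ ^ 2 - s₃ * ξ + σ - 2) :
    x * (ξ - x ^ 2) = (z - x) * s := by
  obtain ⟨η, rfl⟩ : ∃ η, ξ = η + y + s₂ + 1 := ⟨ξ - y - s₂ - 1, by ring⟩
  have hη : η * (s₂ + 1) = y - x * z - 1 := by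
    linear_combination hξ1 + hσ + hs₃
  have hz : z * (x * η + z) = 0 := by
    subst hσ hs₃
    linear_combination y * hη + hξ2 + hs₂ - hs
  suffices h : x * η + z = 0 by
    linear_combination h + x * hs₂ - hQ
  rcases mul_eq_zero.mp hz with rfl | h
  · rcases mul_eq_zero.mp (show x * (1 - y) = 0 by linear_combination hQ) with rfl | hy
    · simp
    · obtain rfl : y = 1 := by linear_combination -hy
      have h2 : s₂ = 1 := by linear_combination hs₂ - hs
      subst h2
      linear_combination x / 2 * hη
  · exact h
end
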